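/- arXiv:2212.13687 — 5 statements merged into one kernel-verified Lean document; each statement's English description precedes it below -/
import Mathlib

section
/- For every real number α with α/(2π) ∉ ℤ and every integer n ≥ 2, the absolutely convergent bilateral series satisfies ∑_{k ∈ ℤ} 1/(2kπ + α)^n = (1/(2^n (n−1)! sin^n(α/2))) · ∑_{l=1}^{n−1} cos((n/2 − l)α) · Ā(n,l). -/
open Finset Filter Real

/-- The number of cyclic descents of a permutation `σ` of `{0, …, n-1}`, read cyclically:
positions `i` with `σ(i) > σ(i+1)`, indices mod `n`. -/
def cyclicDescents (n : ℕ) (σ : Equiv.Perm (Fin n)) : ℕ :=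
  (Finset.univ.filter (fun i : Fin n => σ (finRotate n i) < σ i)).card

/-- The circular Eulerian number `Ā(n,l)`: the number of circular `n`-permutations with exactly
`l` descents.  Each circular permutation has exactly `n` linear representatives (all with the
same number of cyclic descents), whence the division by `n`. -/
def circEulerian (n l : ℕ) : ℕ :=
  (Finset.univ.filter (fun σ : Equiv.Perm (Fin n) => cyclicDescents n σ = l)).card / n

lemma cd_eq_sum (n : ℕ) (σ : Equiv.Perm (Fin (n + 1))) :
    cyclicDescents (n + 1) σ = ∑ i : Fin (n + 1), if σ (i + 1) < σ i then 1 else 0 := by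
  unfold cyclicDescents
  rw [Finset.card_filter]
  simp only [finRotate_apply]

lemma cd_rot (n : ℕ) (σ : Equiv.Perm (Fin (n + 1))) (p : Fin (n + 1)) :
    cyclicDescents (n + 1) (σ * Equiv.addRight p) = cyclicDescents (n + 1) σ := by
  rw [cd_eq_sum, cd_eq_sum]
  refine Fintype.sum_equiv (Equiv.addRight p) _ _ fun i => ?_
  simp only [Equiv.Perm.mul_apply, Equiv.coe_addRight]
  have e : i + 1 + p = i + p + 1 := add_right_comm _ _ _
  simp only [e]
  congr

/-- insertion of a new minimum at position `0`. -/
def insMin (n : ℕ) (w : Equiv.Perm (Fin n)) : Equiv.Perm (Fin (n + 1)) :=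
  Equiv.Perm.decomposeFin.symm (0, w)

lemma insMin_zero (n : ℕ) (w : Equiv.Perm (Fin n)) : insMin n w 0 = 0 := by simp [insMin]

lemma insMin_succ (n : ℕ) (w : Equiv.Perm (Fin n)) (i : Fin n) :
    insMin n w i.succ = (w i).succ := by simp [insMin]

lemma cd_insMin (m : ℕ) (w : Equiv.Perm (Fin (m + 1))) :
    cyclicDescents (m + 2) (insMin (m + 1) w) =
      if w (Fin.last m + 1) < w (Fin.last m) then cyclicDescents (m + 1) w
      else cyclicDescents (m + 1) w + 1 := by
  have h1 : cyclicDescents (m + 2) (insMin (m + 1) w) =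
      (∑ k : Fin m, if w k.succ < w k.castSucc then 1 else 0) + 1 := by
    rw [cd_eq_sum, Fin.sum_univ_succ, Fin.sum_univ_castSucc]
    have e1 : ∀ k : Fin m, (k.castSucc.succ + 1 : Fin (m + 2)) = k.succ.succ := by
      intro k
      rw [Fin.succ_castSucc, Fin.coeSucc_eq_succ]
    have e2 : ((Fin.last m).succ + 1 : Fin (m + 2)) = 0 := by
      rw [Fin.succ_last, Fin.last_add_one]
    simp only [e1, e2, insMin_zero, insMin_succ, Fin.succ_lt_succ_iff]
    simp
  have h2 : cyclicDescents (m + 1) w =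
      (∑ k : Fin m, if w k.succ < w k.castSucc then 1 else 0) +
        if w (Fin.last m + 1) < w (Fin.last m) then 1 else 0 := by
    rw [cd_eq_sum, Fin.sum_univ_castSucc]
    simp only [Fin.coeSucc_eq_succ]
  rw [h1, h2]
  split_ifs <;> rfl

lemma sum_perm_inv (n : ℕ) (F : Equiv.Perm (Fin (n + 1)) → ℝ)
    (hF : ∀ σ p, F (σ * Equiv.addRight p) = F σ) :
    ∑ σ, F σ = (n + 1) * ∑ w : Equiv.Perm (Fin n), F (insMin n w) := by
  have h1 : ∑ σ, F σ = ∑ σ, ∑ p : Fin (n + 1), if σ p = 0 then F σ else 0 := by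
    refine Finset.sum_congr rfl fun σ _ => ?_
    have : ∀ p, (σ p = 0) ↔ (p = σ.symm 0) := fun p => (Equiv.eq_symm_apply σ).symm
    simp [this]
  have h2 : ∀ p : Fin (n + 1), (∑ σ : Equiv.Perm (Fin (n + 1)), if σ p = 0 then F σ else 0) =
      ∑ σ : Equiv.Perm (Fin (n + 1)), if σ 0 = 0 then F σ else 0 := by
    intro p
    refine Fintype.sum_equiv (Equiv.mulRight (Equiv.addRight p)) _ _ fun σ => ?_
    simp only [Equiv.coe_mulRight, hF, Equiv.Perm.mul_apply, Equiv.coe_addRight, zero_add]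
  rw [h1, Finset.sum_comm, Finset.sum_congr rfl (fun p _ => h2 p)]
  simp only [Finset.sum_const, Finset.card_univ, Fintype.card_fin, nsmul_eq_mul, Nat.cast_add,
    Nat.cast_one]
  congr 1
  rw [← Equiv.sum_comp Equiv.Perm.decomposeFin.symm, Fintype.sum_prod_type]
  simp only [Equiv.Perm.decomposeFin_symm_apply_zero]
  rw [Finset.sum_eq_single 0]
  · simp [insMin]
  · intro b _ hb
    simp [hb]
  · simp

lemma main_rec (m : ℕ) (f : ℕ → ℝ) :
    ((m + 1 : ℕ) : ℝ) * ∑ σ, f (cyclicDescents (m + 2) σ) =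
      ((m + 2 : ℕ) : ℝ) * ∑ w, ((cyclicDescents (m + 1) w : ℝ) * f (cyclicDescents (m + 1) w) +
        (((m + 1 : ℕ) : ℝ) - cyclicDescents (m + 1) w) * f (cyclicDescents (m + 1) w + 1)) := by
  rw [sum_perm_inv (m + 1) (fun σ => f (cyclicDescents (m + 2) σ))
    (fun σ p => by simp only [cd_rot])]
  simp only [cd_insMin]
  set g : Equiv.Perm (Fin (m + 1)) → Fin (m + 1) → ℝ := fun w i =>
    if w (i + 1) < w i then f (cyclicDescents (m + 1) w)
    else f (cyclicDescents (m + 1) w + 1) with hg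
  have h0 : ∀ w, f (if w (Fin.last m + 1) < w (Fin.last m) then cyclicDescents (m + 1) w
      else cyclicDescents (m + 1) w + 1) = g w (Fin.last m) := by
    intro w
    simp only [hg]
    split_ifs <;> rfl
  simp only [h0]
  have h1 : ∀ i, ∑ w, g w i = ∑ w, g w (Fin.last m) := by
    intro i
    refine Fintype.sum_equiv (Equiv.mulRight (Equiv.addRight (i - Fin.last m))) _ _ fun σ => ?_
    simp only [hg, Equiv.coe_mulRight, cd_rot, Equiv.Perm.mul_apply, Equiv.coe_addRight]
    have e1 : Fin.last m + 1 + (i - Fin.last m) = i + 1 := by abel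
    have e2 : Fin.last m + (i - Fin.last m) = i := by abel
    rw [e1, e2]
  have h2 : ((m + 1 : ℕ) : ℝ) * ∑ w, g w (Fin.last m) = ∑ w, ∑ i, g w i := by
    rw [Finset.sum_comm, Finset.sum_congr rfl (fun i _ => h1 i)]
    simp
  have h3 : ∀ w, ∑ i, g w i = (cyclicDescents (m + 1) w : ℝ) * f (cyclicDescents (m + 1) w) +
        (((m + 1 : ℕ) : ℝ) - cyclicDescents (m + 1) w) * f (cyclicDescents (m + 1) w + 1) := by
    intro w
    have hc : (cyclicDescents (m + 1) w : ℝ) = ∑ i : Fin (m + 1), if w (i + 1) < w i then (1:ℝ) else 0 := by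
      rw [cd_eq_sum]; push_cast; rfl
    have : ∀ i, g w i = (if w (i + 1) < w i then (1:ℝ) else 0) *
        (f (cyclicDescents (m + 1) w) - f (cyclicDescents (m + 1) w + 1))
        + f (cyclicDescents (m + 1) w + 1) := by
      intro i
      simp only [hg]
      split_ifs <;> ring
    rw [Finset.sum_congr rfl (fun i _ => this i), Finset.sum_add_distrib, ← Finset.sum_mul, ← hc]
    simp only [Finset.sum_const, Finset.card_univ, Fintype.card_fin, nsmul_eq_mul]
    ring
  rw [← Finset.sum_congr rfl (fun w _ => h3 w), ← h2]
  push_cast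
  ring

lemma cd_pos (m : ℕ) (σ : Equiv.Perm (Fin (m + 2))) : 1 ≤ cyclicDescents (m + 2) σ := by
  unfold cyclicDescents
  refine Finset.card_pos.mpr ⟨(finRotate _).symm (σ.symm 0), ?_⟩
  simp only [Finset.mem_filter, Finset.mem_univ, true_and, Equiv.apply_symm_apply]
  refine Fin.pos_of_ne_zero fun h => ?_
  have h2 : (finRotate (m+2)).symm (σ.symm 0) = σ.symm 0 := by
    rw [Equiv.eq_symm_apply, h]
  rw [Equiv.symm_apply_eq, finRotate_apply] at h2
  simp at h2

lemma cd_le (m : ℕ) (σ : Equiv.Perm (Fin (m + 2))) : cyclicDescents (m + 2) σ ≤ m + 1 := by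
  unfold cyclicDescents
  have : (Finset.univ.filter (fun i : Fin (m+2) => σ (finRotate (m+2) i) < σ i)).card
      < (Finset.univ : Finset (Fin (m+2))).card := by
    refine Finset.card_lt_card (Finset.ssubset_univ_iff.mpr fun h => ?_)
    have := Finset.mem_univ ((finRotate (m+2)).symm (σ.symm (Fin.last _)))
    rw [← h] at this
    simp only [Finset.mem_filter, Finset.mem_univ, true_and, Equiv.apply_symm_apply] at this
    exact absurd (Fin.le_last _) (not_le.mpr this)
  simp only [Finset.card_univ, Fintype.card_fin] at this
  omega

lemma circEulerian_mul (m l : ℕ) : (m + 2) * circEulerian (m + 2) l =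
    (Finset.univ.filter
      (fun σ : Equiv.Perm (Fin (m + 2)) => cyclicDescents (m + 2) σ = l)).card := by
  unfold circEulerian
  refine Nat.mul_div_cancel' ?_
  have h := main_rec m (fun k => if k = l then 1 else 0)
  set N := (Finset.univ.filter
      (fun σ : Equiv.Perm (Fin (m + 2)) => cyclicDescents (m + 2) σ = l)).card with hN
  have h1 : ∑ σ : Equiv.Perm (Fin (m + 2)), (if cyclicDescents (m + 2) σ = l then (1:ℝ) else 0) = N := by
    rw [hN, Finset.card_filter]; push_cast; rfl
  rw [h1] at h
  have h2 : ((m + 1) * N : ℤ) = (m + 2) * ∑ w : Equiv.Perm (Fin (m + 1)),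
      ((cyclicDescents (m + 1) w : ℤ) * (if cyclicDescents (m + 1) w = l then 1 else 0) +
        (((m + 1 : ℕ) : ℤ) - cyclicDescents (m + 1) w) *
          (if cyclicDescents (m + 1) w + 1 = l then 1 else 0)) := by
    have : (((m + 1) * N : ℤ) : ℝ) = (((m + 2) * ∑ w : Equiv.Perm (Fin (m + 1)),
      ((cyclicDescents (m + 1) w : ℤ) * (if cyclicDescents (m + 1) w = l then 1 else 0) +
        (((m + 1 : ℕ) : ℤ) - cyclicDescents (m + 1) w) *
          (if cyclicDescents (m + 1) w + 1 = l then 1 else 0)) : ℤ) : ℝ) := by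
      push_cast
      push_cast at h
      exact h
    exact_mod_cast this
  have h3 : ((m + 2 : ℕ) : ℤ) ∣ ((m + 1 : ℕ) : ℤ) * (N : ℤ) := by
    push_cast
    push_cast at h2
    exact Dvd.intro _ h2.symm
  have h4 : (m + 2) ∣ (m + 1) * N := by exact_mod_cast h3
  refine Nat.Coprime.dvd_of_dvd_mul_left ?_ h4
  exact (Nat.coprime_self_add_left (m := m + 1) (n := 1)).mpr (by simp)

lemma sum_circEulerian (m : ℕ) (c : ℕ → ℝ) :
    ((m + 2 : ℕ) : ℝ) * ∑ l ∈ Finset.Icc 1 (m + 1), c l * (circEulerian (m + 2) l : ℝ) =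
      ∑ σ, c (cyclicDescents (m + 2) σ) := by
  rw [← Finset.sum_fiberwise_of_maps_to (s := Finset.univ) (t := Finset.Icc 1 (m + 1))
    (g := fun σ => cyclicDescents (m + 2) σ)
    (fun σ _ => Finset.mem_Icc.mpr ⟨cd_pos m σ, cd_le m σ⟩), Finset.mul_sum]
  refine Finset.sum_congr rfl fun l _ => ?_
  rw [Finset.sum_congr rfl (g := fun _ => c l)
    (fun σ hσ => by rw [(Finset.mem_filter.mp hσ).2])]
  rw [Finset.sum_const, ← circEulerian_mul, nsmul_eq_mul]
  push_cast
  ring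

lemma summable_pow_inv (x : ℝ) (n : ℕ) (hn : 2 ≤ n) :
    Summable fun k : ℤ => 1 / |(k : ℝ) + x| ^ n := by
  have := (Real.summable_one_div_int_add_rpow x n).mpr (by exact_mod_cast hn)
  simpa only [Real.rpow_natCast] using this

lemma exists_delta (x : ℝ) (hx : ∀ k : ℤ, (k : ℝ) + x ≠ 0) :
    ∃ δ > 0, ∀ y ∈ Metric.ball x δ, ∀ k : ℤ, |(k : ℝ) + x| / 2 ≤ |(k : ℝ) + y| := by
  have hd : 0 < |x - round x| := by
    rw [abs_pos]
    have := hx (-round x)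
    push_cast at this
    intro h
    apply this
    linarith
  refine ⟨|x - round x| / 2, by positivity, fun y hy k => ?_⟩
  have h1 : |x - round x| ≤ |(k : ℝ) + x| := by
    have := round_le x (-k)
    push_cast at this
    rwa [sub_neg_eq_add, add_comm x] at this
  have h2 : |y - x| < |x - round x| / 2 := by simpa [Real.dist_eq] using hy
  have h3 : |(k : ℝ) + x| ≤ |(k : ℝ) + y| + |y - x| := by
    have := abs_sub_le ((k : ℝ) + x) ((k : ℝ) + x - ((k : ℝ) + y)) 0
    have e : (k : ℝ) + x = ((k : ℝ) + y) - (y - x) := by ring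
    rw [e]
    exact abs_sub _ _
  linarith

lemma hasDerivAt_term (n : ℕ) (a y : ℝ) (h : a + y ≠ 0) :
    HasDerivAt (fun z : ℝ => 1 / (a + z) ^ n) (-(n : ℝ) / (a + y) ^ (n + 1)) y := by
  have h1 : HasDerivAt (fun z : ℝ => a + z) 1 y := (hasDerivAt_id y).const_add a
  have h2 := (h1.fun_pow n).fun_inv (pow_ne_zero n h)
  simp only [one_div]
  refine h2.congr_deriv ?_
  rcases n with _ | n
  · simp
  · field_simp
    simp only [Nat.add_sub_cancel]
    ring

lemma deriv_bound (n : ℕ) (x y : ℝ) (k : ℤ) (hx : (k : ℝ) + x ≠ 0)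
    (h : |(k : ℝ) + x| / 2 ≤ |(k : ℝ) + y|) :
    ‖-(n : ℝ) / ((k : ℝ) + y) ^ (n + 1)‖ ≤ n * 2 ^ (n + 1) * (1 / |(k : ℝ) + x| ^ (n + 1)) := by
  have hp : 0 < |(k : ℝ) + x| := abs_pos.mpr hx
  rw [Real.norm_eq_abs, abs_div, abs_neg, abs_pow, Nat.abs_cast]
  have : (|(k : ℝ) + x| / 2) ^ (n + 1) ≤ |(k : ℝ) + y| ^ (n + 1) :=
    pow_le_pow_left₀ (by positivity) h _
  calc (n : ℝ) / |(k : ℝ) + y| ^ (n + 1) ≤ n / (|(k : ℝ) + x| / 2) ^ (n + 1) := by gcongr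
    _ = _ := by rw [div_pow]; field_simp

lemma ne_of_half {x y : ℝ} {k : ℤ} (hx : (k : ℝ) + x ≠ 0)
    (h : |(k : ℝ) + x| / 2 ≤ |(k : ℝ) + y|) : (k : ℝ) + y ≠ 0 := by
  have hp : 0 < |(k : ℝ) + x| := abs_pos.mpr hx
  exact abs_pos.mp (by linarith)

lemma hasDerivAt_series (n : ℕ) (hn : 2 ≤ n) (x : ℝ) (hx : ∀ k : ℤ, (k : ℝ) + x ≠ 0) :
    HasDerivAt (fun z : ℝ => ∑' k : ℤ, 1 / ((k : ℝ) + z) ^ n)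
      (-(n : ℝ) * ∑' k : ℤ, 1 / ((k : ℝ) + x) ^ (n + 1)) x := by
  obtain ⟨δ, hδ, hb⟩ := exists_delta x hx
  have := hasDerivAt_tsum_of_isPreconnected (y := x) (y₀ := x)
    (g := fun (k : ℤ) (z : ℝ) => 1 / ((k : ℝ) + z) ^ n)
    (g' := fun (k : ℤ) (z : ℝ) => -(n : ℝ) / ((k : ℝ) + z) ^ (n + 1))
    ((summable_pow_inv x (n + 1) (by omega)).mul_left ((n : ℝ) * 2 ^ (n + 1)))
    Metric.isOpen_ball (convex_ball x δ).isPreconnected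
    (fun k y hy => hasDerivAt_term n k y (ne_of_half (hx k) (hb y hy k)))
    (fun k y hy => deriv_bound n x y k (hx k) (hb y hy k))
    (Metric.mem_ball_self hδ)
    (Summable.of_norm (by
      simpa [abs_pow, abs_inv] using summable_pow_inv x n hn))
    (Metric.mem_ball_self hδ)
  refine this.congr_deriv ?_
  rw [← tsum_mul_left]
  refine tsum_congr fun k => ?_
  ring

lemma cot_series_real (x : ℝ) (hx : ∀ k : ℤ, (k : ℝ) + x ≠ 0) :
    π * (Real.cos (π * x) / Real.sin (π * x)) - 1 / x =
      ∑' n : ℕ, (1 / (x - (n + 1)) + 1 / (x + (n + 1))) := by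
  have hz : (x : ℂ) ∈ Complex.integerComplement := by
    rw [Complex.mem_integerComplement_iff]
    rintro ⟨k, hk⟩
    apply hx (-k)
    have : (k : ℝ) = x := by exact_mod_cast hk
    push_cast
    linarith
  have := cot_series_rep' hz
  rw [Complex.cot_eq_cos_div_sin] at this
  apply Complex.ofReal_injective
  push_cast
  exact this

lemma cot_summable_real (x : ℝ) (hx : ∀ k : ℤ, (k : ℝ) + x ≠ 0) :
    Summable fun n : ℕ => (1 / (x - (n + 1)) + 1 / (x + (n + 1))) := by
  have hz : (x : ℂ) ∈ Complex.integerComplement := by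
    rw [Complex.mem_integerComplement_iff]
    rintro ⟨k, hk⟩
    apply hx (-k)
    have : (k : ℝ) = x := by exact_mod_cast hk
    push_cast
    linarith
  have := summable_cotTerm hz
  rw [← Complex.summable_ofReal]
  refine this.congr fun n => ?_
  simp [cotTerm]

lemma sin_ne (x : ℝ) (hx : ∀ k : ℤ, (k : ℝ) + x ≠ 0) : Real.sin (π * x) ≠ 0 := by
  rw [Real.sin_ne_zero_iff]
  intro k h
  apply hx (-k)
  have : (k : ℝ) = x := by
    apply mul_left_cancel₀ Real.pi_ne_zero
    linarith
  push_cast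
  linarith

lemma base_series (x : ℝ) (hx : ∀ k : ℤ, (k : ℝ) + x ≠ 0) :
    ∑' k : ℤ, 1 / ((k : ℝ) + x) ^ 2 = π ^ 2 / Real.sin (π * x) ^ 2 := by
  obtain ⟨δ, hδ, hb⟩ := exists_delta x hx
  have hs := summable_pow_inv x 2 le_rfl
  have hinj1 : Function.Injective (fun n : ℕ => (n : ℤ) + 1) := fun a b h => by simpa using h
  have hinj2 : Function.Injective (fun n : ℕ => -((n : ℤ) + 1)) := fun a b h => by simpa using h
  have key := hasDerivAt_tsum_of_isPreconnected (y := x) (y₀ := x)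
    (g := fun (n : ℕ) (z : ℝ) => 1 / (((-((n : ℤ) + 1) : ℤ) : ℝ) + z) ^ 1
      + 1 / ((((n : ℤ) + 1 : ℤ) : ℝ) + z) ^ 1)
    (g' := fun (n : ℕ) (z : ℝ) => -((1 : ℕ) : ℝ) / (((-((n : ℤ) + 1) : ℤ) : ℝ) + z) ^ (1 + 1)
      + -((1 : ℕ) : ℝ) / ((((n : ℤ) + 1 : ℤ) : ℝ) + z) ^ (1 + 1))
    (((hs.comp_injective hinj2).mul_left (((1 : ℕ) : ℝ) * 2 ^ 2)).add
      ((hs.comp_injective hinj1).mul_left (((1 : ℕ) : ℝ) * 2 ^ 2)))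
    Metric.isOpen_ball (convex_ball x δ).isPreconnected
    (fun k y hy => (hasDerivAt_term 1 _ y (ne_of_half (hx _) (hb y hy _))).add
      (hasDerivAt_term 1 _ y (ne_of_half (hx _) (hb y hy _))))
    (fun k y hy => (norm_add_le _ _).trans (add_le_add
      (deriv_bound 1 x y _ (hx _) (hb y hy _)) (deriv_bound 1 x y _ (hx _) (hb y hy _))))
    (Metric.mem_ball_self hδ)
    ((cot_summable_real x hx).congr fun n => by
      push_cast
      rw [pow_one, pow_one]
      congr 2 <;> ring)
    (Metric.mem_ball_self hδ)
  have hx0 : x ≠ 0 := by simpa using hx 0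
  have hsin := sin_ne x hx
  have hpx : HasDerivAt (fun z : ℝ => π * z) π x := by
    simpa using (hasDerivAt_id x).const_mul π
  have hd : HasDerivAt (fun z : ℝ => π * (Real.cos (π * z) / Real.sin (π * z)) - 1 / z)
      (-(π ^ 2 / Real.sin (π * x) ^ 2) + 1 / x ^ 2) x := by
    have h1 := ((hpx.cos.fun_div hpx.sin hsin).const_mul π).fun_sub (hasDerivAt_inv hx0)
    simp only [one_div]
    refine h1.congr_deriv ?_
    have := Real.sin_sq_add_cos_sq (π * x)
    field_simp
    linear_combination (-x ^ 2 * π ^ 2) * this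
  have hev : (fun z : ℝ => π * (Real.cos (π * z) / Real.sin (π * z)) - 1 / z) =ᶠ[nhds x]
      (fun z : ℝ => ∑' n : ℕ, (1 / (((-((n : ℤ) + 1) : ℤ) : ℝ) + z) ^ 1
      + 1 / ((((n : ℤ) + 1 : ℤ) : ℝ) + z) ^ 1)) := by
    filter_upwards [Metric.ball_mem_nhds x hδ] with y hy
    rw [cot_series_real y (fun k => ne_of_half (hx k) (hb y hy k))]
    refine tsum_congr fun n => ?_
    push_cast
    rw [pow_one, pow_one]
    congr 2 <;> ring
  have heq := hd.unique (key.congr_of_eventuallyEq hev)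
  have hs' : Summable fun k : ℤ => 1 / ((k : ℝ) + x) ^ 2 := by
    simpa [sq_abs] using hs
  have ha := hs'.comp_injective hinj1
  have hc := hs'.comp_injective hinj2
  have hsplit := tsum_of_add_one_of_neg_add_one (f := fun k : ℤ => 1 / ((k : ℝ) + x) ^ 2) ha hc
  have h2 : (∑' n : ℕ, (-((1 : ℕ) : ℝ) / (((-((n : ℤ) + 1) : ℤ) : ℝ) + x) ^ (1 + 1)
      + -((1 : ℕ) : ℝ) / ((((n : ℤ) + 1 : ℤ) : ℝ) + x) ^ (1 + 1))) =
      -((∑' n : ℕ, 1 / ((((n : ℤ) + 1 : ℤ) : ℝ) + x) ^ 2) +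
        ∑' n : ℕ, 1 / (((-((n : ℤ) + 1) : ℤ) : ℝ) + x) ^ 2) := by
    refine Eq.trans ?_ (congrArg Neg.neg (ha.tsum_add hc))
    rw [← tsum_neg]
    refine tsum_congr fun n => ?_
    simp only [Function.comp_apply, Nat.cast_one]
    ring
  rw [h2] at heq
  rw [hsplit]
  simp only [Int.cast_zero, zero_add]
  linarith

/-- The cosine sum over all permutations. -/
noncomputable def permCos (n : ℕ) (y : ℝ) : ℝ :=
  ∑ σ : Equiv.Perm (Fin n), Real.cos (((n : ℝ) - 2 * (cyclicDescents n σ : ℝ)) * y)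

lemma permCos_two (y : ℝ) : permCos 2 y = 2 := by
  have h : ∀ σ : Equiv.Perm (Fin 2), cyclicDescents 2 σ = 1 := fun σ =>
    le_antisymm (cd_le 0 σ) (cd_pos 0 σ)
  simp [permCos, h, Fintype.card_perm]

lemma hasDerivAt_permCos (n : ℕ) (y : ℝ) :
    HasDerivAt (permCos n) (∑ σ : Equiv.Perm (Fin n),
      -Real.sin (((n : ℝ) - 2 * (cyclicDescents n σ : ℝ)) * y) *
        ((n : ℝ) - 2 * (cyclicDescents n σ : ℝ))) y := by
  unfold permCos
  refine HasDerivAt.fun_sum fun σ _ => ?_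
  have : HasDerivAt (fun z : ℝ => ((n : ℝ) - 2 * (cyclicDescents n σ : ℝ)) * z)
      ((n : ℝ) - 2 * (cyclicDescents n σ : ℝ)) y := by
    simpa using (hasDerivAt_id y).const_mul ((n : ℝ) - 2 * (cyclicDescents n σ : ℝ))
  exact this.cos

lemma permCos_rec (m : ℕ) (y : ℝ) :
    ((m + 1 : ℕ) : ℝ) * permCos (m + 2) y = ((m + 2 : ℕ) : ℝ) *
      (((m + 1 : ℕ) : ℝ) * permCos (m + 1) y * Real.cos y -
        (∑ σ : Equiv.Perm (Fin (m + 1)),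
          -Real.sin ((((m + 1 : ℕ) : ℝ) - 2 * (cyclicDescents (m + 1) σ : ℝ)) * y) *
        (((m + 1 : ℕ) : ℝ) - 2 * (cyclicDescents (m + 1) σ : ℝ))) * Real.sin y) := by
  have h := main_rec m (fun d => Real.cos ((((m + 2 : ℕ) : ℝ) - 2 * (d : ℝ)) * y))
  unfold permCos
  rw [h]
  congr 1
  rw [Finset.mul_sum, Finset.sum_mul, Finset.sum_mul, ← Finset.sum_sub_distrib]
  refine Finset.sum_congr rfl fun w _ => ?_
  set d : ℝ := (cyclicDescents (m + 1) w : ℝ) with hd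
  have e1 : (((m + 2 : ℕ) : ℝ) - 2 * d) * y = (((m + 1 : ℕ) : ℝ) - 2 * d) * y + y := by
    push_cast; ring
  have e2 : (((m + 2 : ℕ) : ℝ) - 2 * ((cyclicDescents (m + 1) w + 1 : ℕ) : ℝ)) * y =
      (((m + 1 : ℕ) : ℝ) - 2 * d) * y - y := by
    push_cast; rw [← hd]; ring
  rw [e1, e2, Real.cos_add, Real.cos_sub]
  ring

lemma series_eq (m : ℕ) : ∀ (x : ℝ), (∀ k : ℤ, (k : ℝ) + x ≠ 0) →
    ∑' k : ℤ, 1 / ((k : ℝ) + x) ^ (m + 2) =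
      π ^ (m + 2) / (((m + 2).factorial : ℝ) * Real.sin (π * x) ^ (m + 2)) *
        permCos (m + 2) (π * x) := by
  induction m with
  | zero =>
    intro x hx
    rw [zero_add, base_series x hx, permCos_two]
    have := sin_ne x hx
    simp [Nat.factorial]
    field_simp
  | succ m ih =>
    intro x hx
    have hsin := sin_ne x hx
    obtain ⟨δ, hδ, hb⟩ := exists_delta x hx
    have h1 := hasDerivAt_series (m + 2) (by omega) x hx
    have hev : (fun z : ℝ => ∑' k : ℤ, 1 / ((k : ℝ) + z) ^ (m + 2)) =ᶠ[nhds x]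
        fun z => π ^ (m + 2) / (((m + 2).factorial : ℝ) * Real.sin (π * z) ^ (m + 2)) *
        permCos (m + 2) (π * z) := by
      filter_upwards [Metric.ball_mem_nhds x hδ] with y hy
      exact ih y (fun k => ne_of_half (hx k) (hb y hy k))
    have hpx : HasDerivAt (fun z : ℝ => π * z) π x := by
      simpa using (hasDerivAt_id x).const_mul π
    have hf : ((m + 2).factorial : ℝ) ≠ 0 := by exact_mod_cast Nat.factorial_ne_zero _
    have hd := (((hasDerivAt_const x (π ^ (m + 2))).fun_div
      ((hpx.sin.fun_pow (m + 2)).const_mul ((m + 2).factorial : ℝ))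
      (mul_ne_zero hf (pow_ne_zero _ hsin))).fun_mul
      ((hasDerivAt_permCos (m + 2) (π * x)).comp x hpx))
    have heq := h1.unique (hd.congr_of_eventuallyEq hev)
    have hr := permCos_rec (m + 1) (π * x)
    simp only [Function.comp_apply] at heq
    set D := ∑ σ : Equiv.Perm (Fin (m + 2)),
      -Real.sin ((((m + 2 : ℕ) : ℝ) - 2 * (cyclicDescents (m + 2) σ : ℝ)) * (π * x)) *
        (((m + 2 : ℕ) : ℝ) - 2 * (cyclicDescents (m + 2) σ : ℝ)) with hD
    have hr' : ((m : ℝ) + 2) * permCos (m + 3) (π * x) = ((m : ℝ) + 3) *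
      (((m : ℝ) + 2) * permCos (m + 2) (π * x) * Real.cos (π * x) - D * Real.sin (π * x)) := by
      have e1 : ((m + 1 + 1 : ℕ) : ℝ) = (m : ℝ) + 2 := by push_cast; ring
      have e2 : ((m + 1 + 2 : ℕ) : ℝ) = (m : ℝ) + 3 := by push_cast; ring
      rw [e1, e2] at hr
      exact hr
    have hm2 : (m : ℝ) + 2 ≠ 0 := by positivity
    have hm3 : (m : ℝ) + 3 ≠ 0 := by positivity
    have hfac : ((m + 1 + 2).factorial : ℝ) = ((m : ℝ) + 3) * ((m + 2).factorial : ℝ) := by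
      rw [show m + 1 + 2 = (m + 2) + 1 by ring, Nat.factorial_succ]
      push_cast; ring
    have hP : permCos (m + 1 + 2) (π * x) = ((m : ℝ) + 3) *
      (((m : ℝ) + 2) * permCos (m + 2) (π * x) * Real.cos (π * x) - D * Real.sin (π * x))
        / ((m : ℝ) + 2) := by
      rw [eq_div_iff hm2, ← hr']; ring
    rw [hP, hfac]
    have hT : ∀ T : ℝ, -((m + 2 : ℕ) : ℝ) * T = -((m : ℝ) + 2) * T := by
      intro T; push_cast; ring
    rw [hT] at heq
    rw [show m + 1 + 2 = m + 2 + 1 by ring]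
    apply mul_left_cancel₀ (neg_ne_zero.mpr hm2)
    rw [heq]
    have e5 : m + 2 - 1 = m + 1 := by omega
    rw [e5]
    push_cast
    field_simp
    ring

/-- For `α` with `α/(2π) ∉ ℤ` and `n ≥ 2`, the bilateral series
`∑_{k ∈ ℤ} 1/(2kπ + α)^n` equals
`(1/(2^n (n-1)! sin^n(α/2))) ∑_{l=1}^{n-1} cos((n/2 - l)α) Ā(n,l)`. -/
theorem bilateral_series_eq_circEulerian_sum (α : ℝ)
    (hα : α / (2 * π) ∉ Set.range ((↑) : ℤ → ℝ)) (n : ℕ) (hn : 2 ≤ n) :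
    ∑' k : ℤ, 1 / (2 * (k : ℝ) * π + α) ^ n =
      1 / (2 ^ n * (Nat.factorial (n - 1) : ℝ) * Real.sin (α / 2) ^ n) *
        ∑ l ∈ Finset.Icc 1 (n - 1),
          Real.cos (((n : ℝ) / 2 - (l : ℝ)) * α) * (circEulerian n l : ℝ) := by
  obtain ⟨m, rfl⟩ : ∃ m, n = m + 2 := ⟨n - 2, by omega⟩
  have hpi := Real.pi_ne_zero
  set x : ℝ := α / (2 * π) with hxdef
  have hax : α = 2 * π * x := by rw [hxdef]; field_simp
  have hx : ∀ k : ℤ, (k : ℝ) + x ≠ 0 := by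
    intro k hk
    refine hα ⟨-k, ?_⟩
    push_cast
    linarith
  have hS := series_eq m x hx
  have hsin := sin_ne x hx
  have hL : ∑' k : ℤ, 1 / (2 * (k : ℝ) * π + α) ^ (m + 2) =
      1 / (2 * π) ^ (m + 2) * ∑' k : ℤ, 1 / ((k : ℝ) + x) ^ (m + 2) := by
    rw [← tsum_mul_left]
    refine tsum_congr fun k => ?_
    rw [hax, show 2 * (k : ℝ) * π + 2 * π * x = (2 * π) * ((k : ℝ) + x) by ring, mul_pow,
      one_div_mul_one_div]
  have hC := sum_circEulerian m (fun l => Real.cos ((((m + 2 : ℕ) : ℝ) / 2 - (l : ℝ)) * α))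
  have hP : ∑ σ : Equiv.Perm (Fin (m + 2)), Real.cos ((((m + 2 : ℕ) : ℝ) / 2 -
      (cyclicDescents (m + 2) σ : ℝ)) * α) = permCos (m + 2) (π * x) := by
    unfold permCos
    refine Finset.sum_congr rfl fun σ _ => ?_
    rw [hax]
    congr 1
    ring
  rw [hP] at hC
  rw [hL, hS, ← hC]
  have e1 : m + 2 - 1 = m + 1 := by omega
  have e2 : α / 2 = π * x := by rw [hax]; ring
  rw [e1, e2, Nat.factorial_succ (m + 1), mul_pow]
  have hf : ((m + 1).factorial : ℝ) ≠ 0 := by exact_mod_cast Nat.factorial_ne_zero _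
  have hm : ((m + 2 : ℕ) : ℝ) ≠ 0 := by positivity
  rw [Nat.cast_mul, show m + 1 + 1 = m + 2 by ring]
  generalize ∑ l ∈ Finset.Icc 1 (m + 1), Real.cos ((((m + 2 : ℕ) : ℝ) / 2 - (l : ℝ)) * α) *
    (circEulerian (m + 2) l : ℝ) = Q
  field_simp
end

section
/- For all integers n ≥ 2 and 1 ≤ l ≤ n−1, the circular Eulerian number satisfies Ā(n,l) = ∑_{i=0}^{l} (−1)^i · C(n,i) · (l−i)^{n−1}, where C(n,i) denotes the binomial coefficient. -/
open Finset Filter Real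

/-- `c` acts transitively: the only nonempty closed set is everything. -/
def FullCyc {n : ℕ} (c : Equiv.Perm (Fin n)) : Prop :=
  ∀ s : Set (Fin n), s.Nonempty → (∀ x ∈ s, c x ∈ s) → ∀ y, y ∈ s

/-- number of `v` with `c v < v`. -/
def desc {n : ℕ} (c : Equiv.Perm (Fin n)) : ℕ :=
  (Finset.univ.filter (fun v : Fin n => c v < v)).card

open Classical in
/-- number of full cycles with `l` anti-excedances -/
noncomputable def ecount (n l : ℕ) : ℕ :=
  (Finset.univ.filter (fun c : Equiv.Perm (Fin n) => FullCyc c ∧ desc c = l)).card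

lemma cyclicDescents_eq_desc (n : ℕ) (σ : Equiv.Perm (Fin n)) :
    cyclicDescents n σ = desc (σ * finRotate n * σ⁻¹) := by
  unfold cyclicDescents desc
  apply Finset.card_bij (fun i _ => σ i)
  · intro a ha
    simpa using ha
  · intro a _ b _ h
    exact σ.injective h
  · intro b hb
    refine ⟨σ⁻¹ b, ?_, by simp⟩
    simpa using hb

lemma fullCyc_iff_isConj {n : ℕ} (hn : 2 ≤ n) (c : Equiv.Perm (Fin n)) :
    FullCyc c ↔ ∃ τ : Equiv.Perm (Fin n), τ * finRotate n * τ⁻¹ = c := by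
  have hR := isCycle_finRotate_of_le hn
  have hS := support_finRotate_of_le hn
  constructor
  · intro h
    have hne : ∀ x, c x ≠ x := by
      intro x hx
      have h1 := h {x} ⟨x, rfl⟩ (by rintro _ rfl; simpa using hx)
      have h2 := h1 ⟨0, by omega⟩
      have h3 := h1 ⟨1, by omega⟩
      simp only [Set.mem_singleton_iff] at h2 h3
      rw [← h3] at h2
      simp at h2
    have hc : c.IsCycle := by
      refine ⟨⟨0, by omega⟩, hne _, fun y _ => ?_⟩
      exact h {y | c.SameCycle ⟨0, by omega⟩ y} ⟨_, Equiv.Perm.SameCycle.refl _ _⟩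
        (fun x hx => Equiv.Perm.sameCycle_apply_right.2 hx) y
    have hsup : c.support = Finset.univ := by
      ext x; simp [hne x]
    have := (hR.isConj_iff hc).2 (by rw [hS, hsup])
    exact isConj_iff.1 this
  · rintro ⟨τ, rfl⟩
    have hc : (τ * finRotate n * τ⁻¹).IsCycle := hR.conj
    have hsup : ∀ x, (τ * finRotate n * τ⁻¹) x ≠ x := by
      intro x hx
      have : finRotate n (τ⁻¹ x) ≠ τ⁻¹ x := by
        rw [← Equiv.Perm.mem_support, hS]; simp
      apply this
      apply τ.injective
      simpa using hx
    rintro s ⟨x, hx⟩ hs y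
    obtain ⟨k, rfl⟩ := hc.exists_pow_eq (hsup x) (hsup y)
    generalize τ * finRotate n * τ⁻¹ = c at *
    induction k with
    | zero => simpa using hx
    | succ k ih =>
      rw [pow_succ']
      exact hs _ ih

lemma fiber_card {n : ℕ} (hn : 2 ≤ n) (τ : Equiv.Perm (Fin n)) :
    (Finset.univ.filter (fun σ : Equiv.Perm (Fin n) =>
      σ * finRotate n * σ⁻¹ = τ * finRotate n * τ⁻¹)).card = n := by
  have h1 : Nat.card (Subgroup.centralizer {finRotate n}) = n := by
    rw [Equiv.Perm.nat_card_centralizer, cycleType_finRotate_of_le hn]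
    simp
  classical
  refine Eq.trans ?_ h1
  rw [Nat.card_eq_fintype_card, ← Fintype.card_subtype]
  refine (Fintype.card_congr ((Equiv.mulLeft τ).subtypeEquiv ?_)).symm
  intro k
  rw [Subgroup.mem_centralizer_singleton_iff]
  simp only [Equiv.coe_mulLeft, mul_inv_rev, mul_assoc, mul_right_inj]
  simp only [← mul_assoc, mul_left_inj]
  exact (mul_inv_eq_iff_eq_mul).symm

lemma count_eq {n : ℕ} (hn : 2 ≤ n) (l : ℕ) :
    (Finset.univ.filter (fun σ : Equiv.Perm (Fin n) => cyclicDescents n σ = l)).card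
      = ecount n l * n := by
  classical
  unfold ecount
  rw [Finset.card_eq_sum_card_fiberwise (f := fun σ => σ * finRotate n * σ⁻¹)
    (t := Finset.univ.filter (fun c : Equiv.Perm (Fin n) => FullCyc c ∧ desc c = l))]
  · rw [Finset.sum_const_nat]
    intro c hc
    simp only [Finset.mem_filter, Finset.mem_univ, true_and] at hc
    obtain ⟨τ, hτ⟩ := (fullCyc_iff_isConj hn c).1 hc.1
    have := fiber_card hn τ
    refine Eq.trans ?_ this
    rw [Finset.filter_filter]
    congr 1
    ext σ
    simp only [Finset.mem_filter, Finset.mem_univ, true_and, cyclicDescents_eq_desc]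
    constructor
    · rintro ⟨_, h⟩; rw [h, hτ]
    · intro h
      rw [h, hτ]; exact ⟨hc.2, rfl⟩
  · intro σ hσ
    simp only [Finset.coe_filter, Finset.mem_univ, true_and, Set.mem_ofPred_eq] at hσ ⊢
    exact ⟨(fullCyc_iff_isConj hn _).2 ⟨σ, rfl⟩, by rw [← cyclicDescents_eq_desc, hσ]⟩

lemma dec_succ {n : ℕ} (i : Fin n) (e : Equiv.Perm (Fin n)) (x : Fin n) :
    Equiv.Perm.decomposeFin.symm (i.succ, e) x.succ = if e x = i then 0 else (e x).succ := by
  rw [Equiv.Perm.decomposeFin_symm_apply_succ]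
  split_ifs with h
  · simp [h]
  · rw [Equiv.swap_apply_of_ne_of_ne] <;> simp [h]

lemma full_zero {n : ℕ} (e : Equiv.Perm (Fin (n+1))) :
    ¬ FullCyc (Equiv.Perm.decomposeFin.symm (0, e)) := by
  intro h
  have := h {0} ⟨0, rfl⟩ (by rintro _ rfl; simp) 1
  simp at this

lemma full_succ {n : ℕ} (i : Fin n) (e : Equiv.Perm (Fin n)) :
    FullCyc (Equiv.Perm.decomposeFin.symm (i.succ, e)) ↔ FullCyc e := by
  constructor
  · rintro h s ⟨x, hx⟩ hs y
    have := h {z | (∃ x ∈ s, z = x.succ) ∨ (z = 0 ∧ i ∈ s)} ⟨x.succ, Or.inl ⟨x, hx, rfl⟩⟩ (by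
      rintro z (⟨x, hx, rfl⟩ | ⟨rfl, hi⟩)
      · rw [dec_succ]
        split_ifs with hh
        · right; exact ⟨rfl, hh ▸ hs x hx⟩
        · left; exact ⟨_, hs x hx, rfl⟩
      · left
        exact ⟨i, hi, by simp⟩) y.succ
    rcases this with ⟨x, hx, hh⟩ | ⟨hh, _⟩
    · rw [Fin.succ_inj] at hh; exact hh ▸ hx
    · exact absurd hh (Fin.succ_ne_zero y)
  · rintro h s ⟨x, hx⟩ hs y
    have h0 : (0 : Fin (n+1)) ∈ s → i.succ ∈ s := fun h => by simpa using hs 0 h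
    have hall : ∀ y : Fin n, y.succ ∈ s := by
      apply h {y | y.succ ∈ s}
      · induction x using Fin.cases with
        | zero => exact ⟨i, h0 hx⟩
        | succ x => exact ⟨x, hx⟩
      · intro x hx
        have := hs _ hx
        rw [dec_succ] at this
        split_ifs at this with hh
        · show (e x).succ ∈ s
          rw [hh]; exact h0 this
        · exact this
    induction y using Fin.cases with
    | succ y => exact hall y
    | zero =>
      have := hs _ (hall (e⁻¹ i))
      rw [dec_succ] at this
      simpa using this

lemma desc_succ {n : ℕ} (i : Fin n) (e : Equiv.Perm (Fin n)) :
    desc (Equiv.Perm.decomposeFin.symm (i.succ, e)) + (if i < e⁻¹ i then 1 else 0) = desc e + 1 := by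
  unfold desc
  simp only [Finset.card_filter]
  rw [Fin.sum_univ_succ]
  simp only [Equiv.Perm.decomposeFin_symm_apply_zero, dec_succ, Fin.not_lt_zero, if_false, zero_add]
  rw [← Finset.add_sum_erase _ _ (Finset.mem_univ (e⁻¹ i)),
    ← Finset.add_sum_erase (a := e⁻¹ i) _ (fun v => if e v < v then 1 else 0) (Finset.mem_univ (e⁻¹ i))]
  have : ∀ x ∈ Finset.univ.erase (e⁻¹ i),
      (if (if e x = i then 0 else (e x).succ) < x.succ then 1 else 0) = if e x < x then 1 else 0 := by
    intro x hx
    have : e x ≠ i := by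
      rintro rfl
      simp at hx
    simp [this]
  rw [Finset.sum_congr rfl this]
  simp
  ring

lemma inner_count {n : ℕ} (e : Equiv.Perm (Fin n)) (l : ℕ) :
    ((Finset.univ.filter (fun i : Fin n =>
      desc (Equiv.Perm.decomposeFin.symm (i.succ, e)) = l)).card : ℤ)
      = (if desc e = l then (l : ℤ) else 0) + (if desc e + 1 = l then (n : ℤ) + 1 - l else 0) := by
  have hd : (Finset.univ.filter (fun i : Fin n => i < e⁻¹ i)).card = desc e := by
    unfold desc
    apply Finset.card_bij (fun i _ => e⁻¹ i)
    · intro a ha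
      simpa using ha
    · intro a _ b _ h
      exact (e⁻¹).injective h
    · intro b hb
      exact ⟨e b, by simpa using hb, by simp⟩
  have hd2 := Finset.card_filter_add_card_filter_not (s := (Finset.univ : Finset (Fin n))) (fun i : Fin n => i < e⁻¹ i)
  rw [hd, Finset.card_univ, Fintype.card_fin] at hd2
  by_cases h1 : desc e = l
  · have : (Finset.univ.filter (fun i : Fin n =>
      desc (Equiv.Perm.decomposeFin.symm (i.succ, e)) = l)) = Finset.univ.filter (fun i : Fin n => i < e⁻¹ i) := by
      ext i
      have := desc_succ i e
      simp only [Finset.mem_filter, Finset.mem_univ, true_and]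
      split_ifs at this with hh <;> simp only [hh] <;> simp <;> omega
    rw [this, hd]
    simp [h1]
  · by_cases h2 : desc e + 1 = l
    · have : (Finset.univ.filter (fun i : Fin n =>
        desc (Equiv.Perm.decomposeFin.symm (i.succ, e)) = l)) = Finset.univ.filter (fun i : Fin n => ¬ i < e⁻¹ i) := by
        ext i
        have := desc_succ i e
        simp only [Finset.mem_filter, Finset.mem_univ, true_and]
        split_ifs at this with hh <;> simp only [hh] <;> simp <;> omega
      rw [this, if_neg h1, if_pos h2]
      omega
    · rw [if_neg h1, if_neg h2]
      have : (Finset.univ.filter (fun i : Fin n =>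
        desc (Equiv.Perm.decomposeFin.symm (i.succ, e)) = l)) = ∅ := by
        ext i
        have := desc_succ i e
        simp only [Finset.mem_filter, Finset.mem_univ, true_and]
        split_ifs at this with hh <;> simp <;> omega
      rw [this]; simp

lemma ecount_rec (m l : ℕ) :
    (ecount (m+2) l : ℤ) = l * ecount (m+1) l +
      (if l = 0 then 0 else ((m : ℤ) + 2 - l) * ecount (m+1) (l-1)) := by
  classical
  have h1 : (ecount (m+2) l : ℤ) = ∑ e : Equiv.Perm (Fin (m+1)), if FullCyc e then
      ((Finset.univ.filter (fun i : Fin (m+1) =>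
      desc (Equiv.Perm.decomposeFin.symm (i.succ, e)) = l)).card : ℤ) else 0 := by
    unfold ecount
    rw [Finset.card_filter]
    rw [← Equiv.sum_comp Equiv.Perm.decomposeFin.symm, Fintype.sum_prod_type_right]
    push_cast
    apply Finset.sum_congr rfl
    intro e _
    rw [Fin.sum_univ_succ]
    simp only [full_zero, full_succ]
    by_cases h : FullCyc e <;> simp [h]
  rw [h1]
  simp only [inner_count]
  have h2 : ∀ k, (ecount (m+1) k : ℤ) = ∑ e : Equiv.Perm (Fin (m+1)),
      if FullCyc e then (if desc e = k then 1 else 0) else 0 := by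
    intro k
    unfold ecount
    rw [Finset.card_filter]
    push_cast
    simp only [ite_and]
  rw [h2, h2, Finset.mul_sum, Finset.mul_sum]
  rcases Nat.eq_zero_or_pos l with rfl | hl
  · simp
  · rw [if_neg hl.ne', ← Finset.sum_add_distrib]
    apply Finset.sum_congr rfl
    intro e _
    have : desc e + 1 = l ↔ desc e = l - 1 := by omega
    simp only [this]
    split_ifs <;> push_cast <;> ring

lemma ecount_one (l : ℕ) : ecount 1 l = if l = 0 then 1 else 0 := by
  classical
  unfold ecount
  have h : ∀ c : Equiv.Perm (Fin 1), FullCyc c := by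
    rintro c s ⟨x, hx⟩ _ y
    rwa [Subsingleton.elim y x]
  have h' : ∀ c : Equiv.Perm (Fin 1), desc c = 0 := by
    intro c
    unfold desc
    simp [Subsingleton.elim (c _) _]
  simp only [h, h', true_and]
  by_cases hl : l = 0
  · subst hl; simp
  · simp [hl, Ne.symm hl]

/-- The explicit sum. -/
def fsum (n l : ℕ) : ℤ :=
  ∑ i ∈ Finset.range (l + 1), (-1) ^ i * (Nat.choose n i : ℤ) * ((l : ℤ) - (i : ℤ)) ^ (n - 1)

lemma fsum_rec (m l : ℕ) :
    fsum (m+2) (l+1) = (l+1) * fsum (m+1) (l+1) + ((m : ℤ) + 1 - l) * fsum (m+1) l := by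
  unfold fsum
  rw [Finset.sum_range_succ' _ (l+1), Finset.sum_range_succ' _ (l+1), mul_add, Finset.mul_sum,
    Finset.mul_sum, add_right_comm, ← Finset.sum_add_distrib]
  congr 1
  · apply Finset.sum_congr rfl
    intro i _
    have h1 : ((m+2).choose (i+1) : ℤ) = (m+1).choose i + (m+1).choose (i+1) := by
      exact_mod_cast Nat.choose_succ_succ (m+1) i
    have h2 : ((m:ℤ)+2) * (m+1).choose i = ((m+1).choose i + (m+1).choose (i+1)) * (i+1) := by
      rw [← h1]
      exact_mod_cast Nat.add_one_mul_choose_eq (m+1) i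
    rw [h1]
    push_cast
    have : ((l:ℤ) + 1 - (i+1)) = l - i := by ring
    rw [this, pow_succ _ m, pow_succ _ i]
    linear_combination -(-1)^i * ((l:ℤ)-i)^m * h2
  · simp [pow_succ]; ring

lemma ecount_eq_fsum (m l : ℕ) : (ecount (m+1) l : ℤ) = fsum (m+1) l := by
  induction m generalizing l with
  | zero =>
    rw [ecount_one]
    unfold fsum
    rcases l with _ | l
    · simp
    · rw [Finset.sum_range_succ', Finset.sum_range_succ']
      simp only [zero_add]
      rw [Finset.sum_eq_zero]
      · simp
      · intro x _
        rw [Nat.choose_eq_zero_of_lt (by omega)]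
        simp
  | succ m ih =>
    rw [ecount_rec]
    rcases l with _ | l
    · simp [fsum]
    · rw [fsum_rec, ← ih, ← ih]
      rw [if_neg (Nat.succ_ne_zero l), Nat.add_sub_cancel]
      push_cast
      ring

/-- `Ā(n,l) = ∑_{i=0}^{l} (-1)^i C(n,i) (l-i)^{n-1}` for `n ≥ 2`, `1 ≤ l ≤ n-1`. -/
theorem circEulerian_eq_sum (n l : ℕ) (hn : 2 ≤ n) (hl1 : 1 ≤ l) (hl : l ≤ n - 1) :
    (circEulerian n l : ℤ) =
      ∑ i ∈ Finset.range (l + 1), (-1) ^ i * (Nat.choose n i : ℤ) * ((l : ℤ) - (i : ℤ)) ^ (n - 1) := by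
  unfold circEulerian
  rw [count_eq hn, Nat.mul_div_cancel _ (by omega)]
  obtain ⟨m, rfl⟩ : ∃ m, n = m + 1 := ⟨n - 1, by omega⟩
  exact ecount_eq_fsum m l
end

section
/- For every integer n ≥ 1, the 2n-th Bernoulli number satisfies B_{2n} = ((−1)^{n+1} n / (2^{3n−2} (2^{2n} − 1))) · ∑_{l=1}^{2n−1} cos((n−l)π/2) · Ā(2n, l). -/
open Finset Filter Real

namespace CE

/-- linear descents -/
def des {m : ℕ} {K : Type*} [LinearOrder K] (f : Fin (m+1) → K) : ℕ :=
  ∑ i : Fin m, if f i.succ < f i.castSucc then 1 else 0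

/-- permutation with first value `j` and remaining pattern `e` -/
def Phi {m : ℕ} (j : Fin (m+1)) (e : Equiv.Perm (Fin m)) : Equiv.Perm (Fin (m+1)) :=
  ((finSuccEquiv m).trans (Equiv.optionCongr e)).trans (finSuccEquiv' j).symm

lemma Phi_zero {m : ℕ} (j : Fin (m+1)) (e : Equiv.Perm (Fin m)) : Phi j e 0 = j := by
  simp [Phi]

lemma Phi_succ {m : ℕ} (j : Fin (m+1)) (e : Equiv.Perm (Fin m)) (i : Fin m) :
    Phi j e i.succ = j.succAbove (e i) := by
  simp [Phi]

lemma Phi_bij (m : ℕ) :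
    Function.Bijective (fun p : Fin (m+1) × Equiv.Perm (Fin m) => Phi p.1 p.2) := by
  rw [Fintype.bijective_iff_injective_and_card]
  constructor
  · rintro ⟨j, e⟩ ⟨k, f⟩ h
    simp only at h
    have h0 : j = k := by
      have := congrArg (fun s => s 0) h
      simpa [Phi_zero] using this
    subst h0
    congr 1
    ext1 i
    have := congrArg (fun s => s i.succ) h
    simpa [Phi_succ] using this
  · simp [Fintype.card_perm, Nat.factorial_succ]

lemma sum_Phi {m : ℕ} {M : Type*} [AddCommMonoid M] (F : Equiv.Perm (Fin (m+1)) → M) :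
    ∑ s, F s = ∑ j, ∑ e, F (Phi j e) := by
  rw [← Fintype.sum_prod_type' (fun j e => F (Phi j e))]
  exact ((Phi_bij m).sum_comp F).symm

lemma des_Phi {m : ℕ} (j : Fin (m+2)) (e : Equiv.Perm (Fin (m+1))) :
    des (Phi j e) = (if (e 0).castSucc < j then 1 else 0) + des e := by
  unfold des
  rw [Fin.sum_univ_succ]
  congr 1
  · rw [Phi_succ, Fin.castSucc_zero, Phi_zero]
    simp only [Fin.succAbove_lt_iff_castSucc_lt]
  · refine Finset.sum_congr rfl fun i _ => ?_
    rw [Phi_succ, ← Fin.succ_castSucc, Phi_succ]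
    simp

lemma des_le {m : ℕ} {K : Type*} [LinearOrder K] (f : Fin (m+1) → K) : des f ≤ m := by
  unfold des
  calc _ ≤ ∑ i : Fin m, 1 := Finset.sum_le_sum fun i _ => by split_ifs <;> simp
    _ = m := by simp

lemma cyc_eq {m : ℕ} (s : Equiv.Perm (Fin (m+1))) :
    cyclicDescents (m+1) s = des s + if s 0 < s (Fin.last m) then 1 else 0 := by
  unfold cyclicDescents des
  rw [Finset.card_filter, Fin.sum_univ_castSucc]
  simp

lemma cyc_Phi {m : ℕ} (e : Equiv.Perm (Fin (m+1))) :
    cyclicDescents (m+2) (Phi (Fin.last _) e) = des e + 1 := by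
  rw [cyc_eq, des_Phi, Phi_zero]
  have : ¬ (Fin.last (m+1) < Phi (Fin.last _) e (Fin.last (m+1))) := not_lt.2 (Fin.le_last _)
  simp [this, Fin.castSucc_lt_last, add_comm]

lemma cyc_rot {m : ℕ} (s : Equiv.Perm (Fin (m+1))) (k : Fin (m+1)) :
    cyclicDescents (m+1) ((Equiv.addRight k).trans s) = cyclicDescents (m+1) s := by
  unfold cyclicDescents
  refine Finset.card_bij (fun i _ => i + k) ?_ ?_ ?_
  · intro i hi
    simp only [Finset.mem_filter, Finset.mem_univ, true_and, finRotate_apply,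
      Equiv.trans_apply, Equiv.coe_addRight] at hi ⊢
    rwa [add_right_comm]
  · intro a _ b _ h
    exact add_right_cancel h
  · intro b hb
    refine ⟨b - k, ?_, by simp⟩
    simp only [Finset.mem_filter, Finset.mem_univ, true_and, finRotate_apply,
      Equiv.trans_apply, Equiv.coe_addRight] at hb ⊢
    rw [add_right_comm]
    simpa using hb

lemma rot_bij (m : ℕ) :
    Function.Bijective (fun p : Fin (m+1) × Equiv.Perm (Fin m) =>
      (Equiv.addRight p.1).trans (Phi (Fin.last m) p.2)) := by
  rw [Fintype.bijective_iff_injective_and_card]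
  constructor
  · rintro ⟨j, e⟩ ⟨k, f⟩ h
    simp only at h
    have h0 : j = k := by
      have := congrArg (fun s => s (-j)) h
      simp only [Equiv.trans_apply, Equiv.coe_addRight, neg_add_cancel, Phi_zero] at this
      have h2 := this.symm.trans (Phi_zero (Fin.last m) f).symm
      have h3 := (Phi (Fin.last m) f).injective h2
      exact (neg_add_eq_zero.1 h3)
    subst h0
    congr 1
    ext1 i
    have := congrArg (fun s => s (i.succ - j)) h
    simpa [Phi_succ] using this
  · simp [Fintype.card_perm, Nat.factorial_succ]

lemma circ_eq (m l : ℕ) : circEulerian (m+2) l =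
    ∑ e : Equiv.Perm (Fin (m+1)), if des e + 1 = l then 1 else 0 := by
  unfold circEulerian
  rw [Finset.card_filter, ← (rot_bij (m+1)).sum_comp, Fintype.sum_prod_type]
  simp only [cyc_rot, cyc_Phi]
  rw [Finset.sum_const, Finset.card_univ, Fintype.card_fin, smul_eq_mul]
  exact Nat.mul_div_cancel_left _ (by omega)

/-- Eulerian polynomials evaluated at `t` -/
noncomputable def A (t : ℂ) : ℕ → ℂ
  | 0 => 1
  | m+1 => ∑ e : Equiv.Perm (Fin (m+1)), t ^ des e

noncomputable def a (t : ℂ) (m : ℕ) (j : Fin (m+1)) : ℂ :=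
  ∑ e : Equiv.Perm (Fin m), t ^ des (Phi j e)

lemma a_rec (t : ℂ) (m : ℕ) (j : Fin (m+2)) :
    a t (m+1) j = ∑ k : Fin (m+1), a t m k * (if k.castSucc < j then t else 1) := by
  unfold a
  rw [sum_Phi]
  refine Finset.sum_congr rfl fun k _ => ?_
  rw [Finset.sum_mul]
  refine Finset.sum_congr rfl fun e _ => ?_
  rw [des_Phi j, Phi_zero, pow_add, mul_comm]
  split_ifs <;> simp

lemma A_succ (t : ℂ) (m : ℕ) : A t (m+1) = ∑ k : Fin (m+1), a t m k := by
  simp only [A, a]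
  rw [sum_Phi]

lemma a_zero (t : ℂ) (m : ℕ) : a t m 0 = A t m := by
  cases m with
  | zero => simp [a, A, des]
  | succ m => rw [a_rec, A_succ]; simp

lemma a_last (t : ℂ) (m : ℕ) : a t (m+1) (Fin.last _) = t * A t (m+1) := by
  rw [a_rec, A_succ]; simp [Fin.castSucc_lt_last, Finset.mul_sum, mul_comm]

lemma a_diff (t : ℂ) (m : ℕ) (j : Fin (m+1)) :
    a t (m+1) j.succ = a t (m+1) j.castSucc + (t-1) * a t m j := by
  rw [a_rec, a_rec, ← sub_eq_iff_eq_add', ← Finset.sum_sub_distrib, Finset.sum_eq_single j]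
  · simp; ring
  · intro k _ hk
    have : k.castSucc < j.succ ↔ k.castSucc < j.castSucc := by
      simp only [Fin.lt_def, Fin.val_succ, Fin.val_castSucc]
      have : (k:ℕ) ≠ j := fun h => hk (Fin.ext h)
      omega
    simp [this]
  · simp

lemma pascal (j : ℕ) (f : ℕ → ℂ) :
    ∑ k ∈ range (j+2), ((j+1).choose k : ℂ) * f k =
      ∑ k ∈ range (j+1), (j.choose k : ℂ) * f (k+1) + ∑ k ∈ range (j+1), (j.choose k : ℂ) * f k := by
  have h : ∑ k ∈ range (j+1), (j.choose k : ℂ) * f k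
      = ∑ k ∈ range (j+2), (j.choose k : ℂ) * f k := by
    rw [Finset.sum_range_succ _ (j+1)]; simp
  rw [h, Finset.sum_range_succ' _ (j+1), Finset.sum_range_succ' _ (j+1), ← add_assoc,
    ← Finset.sum_add_distrib]
  simp [Nat.choose_succ_succ, add_mul]

lemma a_sum (t : ℂ) (ht : t ≠ 1) (j : ℕ) : ∀ (d m : ℕ) (h : j < m + 1), m = d + j →
    a t m ⟨j, h⟩ / (t-1)^m =
      ∑ k ∈ range (j+1), (j.choose k : ℂ) * (A t (d+k) / (t-1)^(d+k)) := by
  have ht' : t - 1 ≠ 0 := sub_ne_zero.2 ht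
  induction j with
  | zero =>
    intro d m h hd
    obtain rfl : d = m := by omega
    simpa using congrArg (· / (t-1)^d) (a_zero t d)
  | succ j ih =>
    intro d m hm hd
    obtain ⟨m, rfl⟩ : ∃ m', m = m' + 1 := ⟨m - 1, by omega⟩
    have h := a_diff t m ⟨j, by omega⟩
    have h1 := ih (d+1) (m+1) (by omega) (by omega)
    have h2 := ih d m (by omega) (by omega)
    simp only [Fin.succ_mk, Fin.castSucc_mk] at h
    rw [h, add_div, h1, pow_succ', mul_div_mul_left _ _ ht', h2,
      pascal j (fun k => A t (d+k) / (t-1)^(d+k))]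
    simp only [add_assoc, add_comm 1]

lemma b_rec (t : ℂ) (ht : t ≠ 1) (m : ℕ) :
    t * (A t m / (t-1)^m) = ∑ k ∈ range (m+1), (m.choose k : ℂ) * (A t k / (t-1)^k)
      + if m = 0 then t - 1 else 0 := by
  cases m with
  | zero => simp [A]
  | succ m =>
    have h := a_sum t ht (m+1) 0 (m+1) (by omega) (by omega)
    simp only [zero_add] at h
    rw [← h]
    have := a_last t m
    simp only [Fin.last] at this
    rw [this]
    simp [mul_div_assoc]

open PowerSeries in
/-- exponential generating function of `A m / (I-1)^m` -/
noncomputable def bS : PowerSeries ℂ :=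
  PowerSeries.mk fun m => A Complex.I m / (Complex.I - 1)^m / (m.factorial : ℂ)

lemma I_ne_one : Complex.I ≠ 1 := by
  intro h
  have := congrArg Complex.re h
  simp at this

open PowerSeries in
lemma bS_eq : bS * (C Complex.I - exp ℂ) = C (Complex.I - 1) := by
  have key : C Complex.I * bS = bS * exp ℂ + C (Complex.I - 1) := by
    ext m
    have h := b_rec Complex.I I_ne_one m
    have hf : (m.factorial : ℂ) ≠ 0 := by exact_mod_cast m.factorial_ne_zero
    rw [map_add, coeff_C_mul, coeff_mul, coeff_C, bS, coeff_mk, ← mul_div_assoc, h, add_div,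
      Finset.Nat.sum_antidiagonal_eq_sum_range_succ_mk, Finset.sum_div]
    congr 1
    · refine Finset.sum_congr rfl fun k hk => ?_
      have hk' : k ≤ m := by simpa [Nat.lt_succ_iff] using hk
      rw [Nat.cast_choose ℂ hk']
      have h1 : (k.factorial : ℂ) ≠ 0 := by exact_mod_cast k.factorial_ne_zero
      have h2 : ((m-k).factorial : ℂ) ≠ 0 := by exact_mod_cast (m-k).factorial_ne_zero
      simp only [coeff_mk, coeff_exp, map_div₀, map_one, map_natCast]
      field_simp
    · split_ifs with h0
      · simp [h0]
      · simp
  linear_combination key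

open PowerSeries in
lemma bS_main : X * (bS - evalNegHom bS) =
    C ((Complex.I - 1) * Complex.I) * (X - rescale 2 (bernoulliPowerSeries ℂ)
      + rescale 4 (bernoulliPowerSeries ℂ)) := by
  set E := exp ℂ with hE
  set c : PowerSeries ℂ := C Complex.I with hc
  have hcc : c * c = -1 := by
    rw [hc, ← map_mul, Complex.I_mul_I]; simp
  have h1 : bS * (c - E) = c - 1 := by rw [hc, hE, bS_eq]; simp
  have h2 : evalNegHom bS * (c - evalNegHom E) = c - 1 := by
    have := congrArg (evalNegHom (A := ℂ)) h1
    have hC : rescale (-1 : ℂ) c = c := by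
      ext k
      rw [coeff_rescale, hc, coeff_C]
      split_ifs with h0 <;> simp [h0]
    simpa [evalNegHom, hC] using this
  have h3 : E * evalNegHom E = 1 := exp_mul_exp_neg_eq_one
  have hb := bernoulliPowerSeries_mul_exp_sub_one ℂ
  have h4 : rescale 2 (bernoulliPowerSeries ℂ) * (E^2 - 1) = 2 * X := by
    have := congrArg (rescale (2:ℂ)) hb
    have e := exp_pow_eq_rescale_exp (A := ℂ) 2
    push_cast at e
    rw [map_mul, map_sub, ← e, map_one, rescale_X] at this
    rw [hE, this, map_ofNat C 2]
  have h5 : rescale 4 (bernoulliPowerSeries ℂ) * (E^4 - 1) = 4 * X := by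
    have := congrArg (rescale (4:ℂ)) hb
    have e := exp_pow_eq_rescale_exp (A := ℂ) 4
    push_cast at e
    rw [map_mul, map_sub, ← e, map_one, rescale_X] at this
    rw [hE, this, map_ofNat C 4]
  have h6 : E^4 - 1 ≠ 0 := by
    intro h
    rw [h, mul_zero] at h5
    have := congrArg (coeff 1) h5
    have e4 : (4 : PowerSeries ℂ) = C 4 := (map_ofNat C 4).symm
    rw [e4, coeff_C_mul] at this
    simp at this
  have hC : C ((Complex.I - 1) * Complex.I) = (c - 1) * c := by simp [hc]
  rw [hC]
  apply mul_right_cancel₀ h6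
  generalize evalNegHom bS = b' at *
  generalize evalNegHom E = E' at *
  generalize rescale 2 (bernoulliPowerSeries ℂ) = β2 at *
  generalize rescale 4 (bernoulliPowerSeries ℂ) = β4 at *
  generalize bS = b at *
  have k1 : b * (1 + E^2) = (c - 1) * (-c - E) := by
    linear_combination (-c - E) * h1 + b * hcc
  have k2 : b' * (c * E - 1) = (c - 1) * E := by
    linear_combination E * h2 + b' * h3
  have k3 : b' * (1 + E^2) = (c - 1) * (-c * E^2 - E) := by
    linear_combination (-c * E - 1) * k2 + b' * E^2 * hcc
  have k4 : (b - b') * (1 + E^2) = (c-1) * c * (E^2 - 1) := by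
    linear_combination k1 - k3
  linear_combination X * (E^2 - 1) * k4 + (c-1) * c * ((E^2 + 1) * h4 - h5)

lemma A_odd (n : ℕ) : A Complex.I (2*n+1) =
    (Complex.I - 1)^(2*n+2) * Complex.I * (bernoulli (2*n+2) : ℂ) *
      (4^(2*n+2) - 2^(2*n+2)) / (2 * (2*n+2)) := by
  have h := congrArg (PowerSeries.coeff (2*n+1+1)) bS_main
  have hI : (Complex.I - 1) ≠ 0 := sub_ne_zero.2 I_ne_one
  have hf : ((2*n+1).factorial : ℂ) ≠ 0 := by exact_mod_cast (2*n+1).factorial_ne_zero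
  have hn : (2*(n:ℂ)+2) ≠ 0 := by exact_mod_cast (by omega : 2*n+2 ≠ 0)
  rw [PowerSeries.coeff_succ_X_mul, PowerSeries.coeff_C_mul] at h
  simp only [map_sub, map_add, PowerSeries.evalNegHom, PowerSeries.coeff_rescale,
    PowerSeries.coeff_X, bS, PowerSeries.coeff_mk, bernoulliPowerSeries] at h
  have e1 : (-1 : ℂ)^(2*n+1) = -1 := by rw [pow_succ, pow_mul]; simp
  rw [e1] at h
  simp only [Nat.factorial_succ (2*n+1), Nat.add_eq_right, Nat.succ_ne_zero, if_false] at h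
  simp only [map_div₀, map_mul, map_natCast, eq_ratCast, Rat.cast_div, Rat.cast_natCast] at h
  push_cast at h
  have hn' : (2*(n:ℂ)+1+1) ≠ 0 := by convert hn using 1; ring
  field_simp at h ⊢
  linear_combination h

lemma cos_eq (n l : ℕ) : Real.cos (((n : ℝ) - (l : ℝ)) * π / 2) =
    (Complex.I ^ l * (-Complex.I) ^ n).re := by
  have h : Complex.I ^ l * (-Complex.I) ^ n =
      Complex.exp ((((l : ℝ) - n) * π / 2 : ℝ) * Complex.I) := by
    have e1 : Complex.I = Complex.exp (π / 2 * Complex.I) := Complex.exp_pi_div_two_mul_I.symm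
    have e2 : -Complex.I = Complex.exp (-(π / 2 * Complex.I)) := by
      rw [Complex.exp_neg, ← e1, Complex.inv_I]
    rw [e2]
    nth_rewrite 1 [e1]
    rw [← Complex.exp_nat_mul, ← Complex.exp_nat_mul, ← Complex.exp_add]
    congr 1
    push_cast; ring
  rw [h, Complex.exp_ofReal_mul_I_re, ← Real.cos_neg]
  congr 1; ring

lemma sum_eq (m n : ℕ) :
    ∑ l ∈ Finset.Icc 1 (m+1),
          Real.cos (((n : ℝ) - (l : ℝ)) * π / 2) * (circEulerian (m+2) l : ℝ) =
    (Complex.I * A Complex.I (m+1) * (-Complex.I) ^ n).re := by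
  simp only [circ_eq, A]
  push_cast
  simp only [Finset.mul_sum, Finset.sum_mul, Complex.re_sum]
  rw [Finset.sum_comm]
  refine Finset.sum_congr rfl fun e _ => ?_
  rw [Finset.sum_eq_single (des e + 1)]
  · rw [cos_eq, pow_succ']; simp
  · intro b _ hb
    rw [if_neg (Ne.symm hb)]; simp
  · intro h
    have := des_le e
    simp at h; omega

end CE

theorem bernoulli_eq_circEulerian_sum (n : ℕ) (hn : 1 ≤ n) :
    ((bernoulli (2 * n) : ℚ) : ℝ) =
      ((-1) ^ (n + 1) * (n : ℝ) / (2 ^ (3 * n - 2) * (2 ^ (2 * n) - 1))) *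
        ∑ l ∈ Finset.Icc 1 (2 * n - 1),
          Real.cos (((n : ℝ) - (l : ℝ)) * π / 2) * (circEulerian (2 * n) l : ℝ) := by
  obtain ⟨m, rfl⟩ : ∃ m, n = m + 1 := ⟨n - 1, by omega⟩
  have h := CE.sum_eq (2*m) (m+1)
  rw [show 2 * (m+1) - 1 = 2*m+1 by omega, show 2*(m+1) = 2*m+2 by ring, h, CE.A_odd]
  have hp : (2:ℝ)^(2*m+2) - 1 ≠ 0 := by
    have : (1:ℝ) < 2^(2*m+2) := one_lt_pow₀ (by norm_num) (by omega)
    linarith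
  have e1 : (Complex.I - 1)^(2*m+2) = (-2 * Complex.I)^(m+1) := by
    rw [show 2*m+2 = 2*(m+1) by ring, pow_mul]
    congr 1
    linear_combination Complex.I_sq
  have e2 : Complex.I * ((Complex.I - 1)^(2*m+2) * Complex.I * (bernoulli (2*m+2) : ℂ) *
      (4^(2*m+2) - 2^(2*m+2)) / (2 * (2*m+2))) * (-Complex.I) ^ (m+1) =
      ((-(-2)^(m+1) * (bernoulli (2*m+2) : ℝ) *
      (4^(2*m+2) - 2^(2*m+2)) / (2 * (2*m+2)) : ℝ) : ℂ) := by
    rw [e1]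
    have : (-2 * Complex.I)^(m+1) * (-Complex.I)^(m+1) = (-2)^(m+1) := by
      rw [← mul_pow]; congr 1; linear_combination 2 * Complex.I_sq
    push_cast
    linear_combination (Complex.I^2 * (bernoulli (2*m+2) : ℂ) *
      (4^(2*m+2) - 2^(2*m+2)) / (2 * (2*m+2))) * this + ((-2)^(m+1) * (bernoulli (2*m+2) : ℂ) *
      (4^(2*m+2) - 2^(2*m+2)) / (2 * (2*m+2))) * Complex.I_sq
  rw [e2, Complex.ofReal_re]
  have e3 : (4:ℝ)^(2*m+2) - 2^(2*m+2) = 2^(2*m+2) * (2^(2*m+2) - 1) := by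
    rw [show (4:ℝ) = 2*2 by norm_num, mul_pow]; ring
  have e4 : (-2:ℝ)^(m+1) = (-1)^(m+1) * 2^(m+1) := by rw [← mul_pow]; norm_num
  have e5 : ((-1:ℝ)^(m+1))*(-1)^(m+1) = 1 := by rw [← mul_pow]; norm_num
  rw [e3, e4, show 3*(m+1) - 2 = 3*m+1 by omega]
  push_cast
  have hm : (m:ℝ) + 1 ≠ 0 := by positivity
  have hm2 : 2 * (m:ℝ) + 2 ≠ 0 := by positivity
  rw [pow_succ (-1:ℝ) (m+1)]
  generalize (2:ℝ)^(2*m+2) - 1 = Q at *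
  field_simp
  have e6 : (2:ℝ)^(3*m+1) * 4 = 2^(m+1) * 2^(2*m+2) := by ring
  linear_combination (bernoulli (2*m+2) : ℝ) * e6
    - (bernoulli (2*m+2) : ℝ) * 2 ^ (m + 1) * 2 ^ (2 * m + 2) * e5
end

section
/- Let N > 2, let χ be a Dirichlet character modulo N, and let n ≥ 2 be an integer with χ(−1) = (−1)^n. Then L(n, χ) = (π^n / (2(n−1)! N^n)) · ∑_{m=1}^{N−1} (χ(m) / sin^n(mπ/N)) · ∑_{l=1}^{n−1} cos((n−2l)mπ/N) · Ā(n, l). -/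
open Finset Filter Real

lemma cyclicDescents_mul_rotate (n : ℕ) (σ : Equiv.Perm (Fin n)) :
    cyclicDescents n (σ * finRotate n) = cyclicDescents n σ := by
  unfold cyclicDescents
  refine Finset.card_equiv (finRotate n) ?_
  intro i
  simp

lemma cyc_double_count (m l c : ℕ) (Q : Equiv.Perm (Fin (m + 1)) → Fin (m + 1) → Prop)
    [∀ σ i, Decidable (Q σ i)]
    (hQ : ∀ σ i, Q (σ * finRotate (m + 1)) i ↔ Q σ (finRotate (m + 1) i))
    (hc : ∀ σ, cyclicDescents (m + 1) σ = l → (univ.filter (fun i => Q σ i)).card = c) :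
    c * (univ.filter (fun σ => cyclicDescents (m + 1) σ = l)).card =
      (m + 1) * (univ.filter (fun σ => cyclicDescents (m + 1) σ = l ∧ Q σ (Fin.last m))).card := by
  set f : Fin (m + 1) → ℕ := fun i =>
    (univ.filter (fun σ => cyclicDescents (m + 1) σ = l ∧ Q σ i)).card with hf
  have hstep : ∀ i, f (finRotate (m + 1) i) = f i := by
    intro i
    refine Finset.card_equiv (Equiv.mulRight (finRotate (m + 1))) ?_
    intro σ
    simp [cyclicDescents_mul_rotate, hQ]
  have hconst : ∀ i, f i = f 0 := by
    intro i
    induction i using Fin.induction with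
    | zero => rfl
    | succ j ih =>
      rw [← ih, ← hstep j.castSucc, finRotate_apply, Fin.coeSucc_eq_succ]
  have h1 : ∑ i, f i = (m + 1) * f (Fin.last m) := by
    rw [hconst (Fin.last m), Finset.sum_congr rfl (fun i _ => hconst i)]
    simp
  rw [← h1]
  have h2 := Finset.sum_card_bipartiteAbove_eq_sum_card_bipartiteBelow
    (s := univ.filter (fun σ => cyclicDescents (m + 1) σ = l)) (t := (univ : Finset (Fin (m+1)))) Q
  rw [Finset.sum_congr rfl (g := fun _ => c)] at h2
  · rw [Finset.sum_const, smul_eq_mul, mul_comm] at h2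
    rw [h2]
    refine Finset.sum_congr rfl fun i _ => ?_
    simp [hf, Finset.bipartiteBelow, Finset.filter_filter]
  · intro σ hσ
    exact hc σ (by simpa using hσ)

/-- Representatives with the maximum in last position. -/
def cycE (m l : ℕ) : ℕ :=
  (univ.filter (fun σ : Equiv.Perm (Fin (m + 1)) =>
    cyclicDescents (m + 1) σ = l ∧ σ (Fin.last m) = Fin.last m)).card

lemma card_eq_cycE (m l : ℕ) :
    (univ.filter (fun σ : Equiv.Perm (Fin (m + 1)) => cyclicDescents (m + 1) σ = l)).card
      = (m + 1) * cycE m l := by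
  have := cyc_double_count m l 1 (fun σ i => σ i = Fin.last m) (fun σ i => by simp) (by
    intro σ _
    rw [Finset.card_eq_one]
    refine ⟨σ.symm (Fin.last m), ?_⟩
    ext i
    simp [Equiv.eq_symm_apply])
  rw [one_mul] at this
  exact this

lemma circEulerian_eq_cycE (m l : ℕ) : circEulerian (m + 1) l = cycE m l := by
  unfold circEulerian
  rw [card_eq_cycE]
  exact Nat.mul_div_cancel_left _ (Nat.succ_pos m)

lemma card_desc (m l : ℕ) :
    (univ.filter (fun σ : Equiv.Perm (Fin (m + 1)) => cyclicDescents (m + 1) σ = l ∧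
      σ (finRotate _ (Fin.last m)) < σ (Fin.last m))).card = l * cycE m l := by
  have := cyc_double_count m l l (fun σ i => σ (finRotate _ i) < σ i) (fun σ i => by simp) (by
    intro σ h
    exact h)
  rw [card_eq_cycE] at this
  apply Nat.eq_of_mul_eq_mul_left (Nat.succ_pos m)
  rw [Nat.succ_eq_add_one, ← this]; ring

lemma card_asc (m l : ℕ) :
    (univ.filter (fun σ : Equiv.Perm (Fin (m + 1)) => cyclicDescents (m + 1) σ = l ∧
      ¬ σ (finRotate _ (Fin.last m)) < σ (Fin.last m))).card = (m + 1 - l) * cycE m l := by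
  have := cyc_double_count m l (m + 1 - l) (fun σ i => ¬ σ (finRotate _ i) < σ i)
    (fun σ i => by simp) (by
    intro σ h
    have h1 := Finset.card_filter_add_card_filter_not (s := (univ : Finset (Fin (m+1))))
      (fun i => σ (finRotate _ i) < σ i)
    simp only [Finset.card_univ, Fintype.card_fin] at h1
    unfold cyclicDescents at h
    omega)
  rw [card_eq_cycE] at this
  apply Nat.eq_of_mul_eq_mul_left (Nat.succ_pos m)
  rw [Nat.succ_eq_add_one, ← this]; ring

/-- Extend a permutation by fixing the last element. -/
def extLast (m : ℕ) (τ : Equiv.Perm (Fin m)) : Equiv.Perm (Fin (m + 1)) :=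
  (finSuccEquivLast.trans τ.optionCongr).trans finSuccEquivLast.symm

lemma extLast_castSucc (m : ℕ) (τ : Equiv.Perm (Fin m)) (i : Fin m) :
    extLast m τ i.castSucc = (τ i).castSucc := by
  simp [extLast]

lemma extLast_last (m : ℕ) (τ : Equiv.Perm (Fin m)) :
    extLast m τ (Fin.last m) = Fin.last m := by
  simp [extLast]

lemma extLast_surj (m : ℕ) (σ : Equiv.Perm (Fin (m + 1))) (h : σ (Fin.last m) = Fin.last m) :
    ∃ τ, extLast m τ = σ := by
  have hne : ∀ i : Fin m, σ i.castSucc ≠ Fin.last m := by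
    intro i hi
    rw [← h] at hi
    exact (Fin.castSucc_lt_last i).ne (σ.injective hi)
  let g : Fin m → Fin m := fun i => (σ i.castSucc).castPred (hne i)
  have hg : Function.Injective g := by
    intro i j hij
    have := congrArg Fin.castSucc hij
    simpa [g] using this
  refine ⟨Equiv.ofBijective g (Finite.injective_iff_bijective.mp hg), ?_⟩
  ext i
  induction i using Fin.lastCases with
  | last => rw [extLast_last, h]
  | cast i => rw [extLast_castSucc]; simp [g]

lemma extLast_inj (m : ℕ) : Function.Injective (extLast m) := by
  intro τ τ' h
  ext i
  have := congrArg (fun s : Equiv.Perm (Fin (m + 1)) => s i.castSucc) h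
  simp only [extLast_castSucc] at this
  simpa using congrArg Fin.val this

lemma cyclicDescents_eq_sum (n : ℕ) (σ : Equiv.Perm (Fin n)) :
    cyclicDescents n σ = ∑ i, if σ (finRotate n i) < σ i then 1 else 0 := by
  simp [cyclicDescents]

lemma cyclicDescents_extLast (m : ℕ) (τ : Equiv.Perm (Fin (m + 1))) :
    cyclicDescents (m + 2) (extLast (m + 1) τ) =
      cyclicDescents (m + 1) τ +
        (if τ (finRotate _ (Fin.last m)) < τ (Fin.last m) then 0 else 1) := by
  rw [cyclicDescents_eq_sum, cyclicDescents_eq_sum, Fin.sum_univ_castSucc, Fin.sum_univ_castSucc,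
    Fin.sum_univ_castSucc]
  have h1 : ∀ j : Fin m, finRotate (m + 2) j.castSucc.castSucc = j.succ.castSucc := by
    intro j
    rw [finRotate_apply, Fin.coeSucc_eq_succ, Fin.succ_castSucc]
  have h2 : ∀ j : Fin m, finRotate (m + 1) j.castSucc = j.succ := by
    intro j
    rw [finRotate_apply, Fin.coeSucc_eq_succ]
  have h3 : finRotate (m + 2) (Fin.last m).castSucc = Fin.last (m + 1) := by
    rw [finRotate_apply, Fin.coeSucc_eq_succ, Fin.succ_last]
  have h4 : finRotate (m + 2) (Fin.last (m + 1)) = (0 : Fin (m + 1)).castSucc := by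
    rw [finRotate_last]; rfl
  simp only [h1, h2, h3, h4, extLast_castSucc, extLast_last, Fin.castSucc_lt_castSucc_iff,
    Fin.castSucc_lt_last, if_true]
  rw [if_neg (not_lt.mpr (Fin.castSucc_lt_last _).le)]
  split_ifs <;> omega

lemma cycE_succ_eq (m l : ℕ) :
    cycE (m + 1) l = (univ.filter (fun τ : Equiv.Perm (Fin (m + 1)) =>
      cyclicDescents (m + 2) (extLast (m + 1) τ) = l)).card := by
  unfold cycE
  symm
  refine Finset.card_bij (fun τ _ => extLast (m + 1) τ) ?_ ?_ ?_
  · intro τ hτ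
    simp only [Finset.mem_filter, Finset.mem_univ, true_and] at hτ ⊢
    exact ⟨hτ, extLast_last _ _⟩
  · intro a _ b _ h
    exact extLast_inj _ h
  · intro σ hσ
    simp only [Finset.mem_filter, Finset.mem_univ, true_and] at hσ
    obtain ⟨τ, rfl⟩ := extLast_surj _ σ hσ.2
    exact ⟨τ, by simpa using hσ.1, rfl⟩

lemma cycE_succ_zero (m : ℕ) : cycE (m + 1) 0 = 0 := by
  rw [cycE_succ_eq]
  have h0 := card_desc m 0
  rw [zero_mul] at h0
  refine Eq.trans (congrArg Finset.card ?_) h0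
  ext τ
  simp only [Finset.mem_filter, Finset.mem_univ, true_and, cyclicDescents_extLast]
  by_cases h : τ (finRotate _ (Fin.last m)) < τ (Fin.last m)
  · rw [if_pos h]; simp only [h, and_true, add_zero]
  · rw [if_neg h]; simp only [h, and_false, iff_false]; omega

lemma cycE_succ_succ (m l : ℕ) :
    cycE (m + 1) (l + 1) = (l + 1) * cycE m (l + 1) + (m + 1 - l) * cycE m l := by
  rw [cycE_succ_eq, ← card_desc, ← card_asc, ← Finset.card_union_of_disjoint]
  · congr 1
    ext τ
    simp only [Finset.mem_filter, Finset.mem_univ, true_and, cyclicDescents_extLast,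
      Finset.mem_union]
    by_cases h : τ (finRotate _ (Fin.last m)) < τ (Fin.last m)
    · rw [if_pos h]; simp only [h, and_true, add_zero, not_true, and_false, or_false]
    · rw [if_neg h]; simp only [h, and_false, not_false_iff, and_true, false_or]; omega
  · rw [Finset.disjoint_filter]
    intro τ _ h1 h2
    exact h2.2 h1.2

lemma cycE_zero_zero : cycE 0 0 = 1 := by decide

lemma cycE_eq_zero (m l : ℕ) (h : m < l) : cycE m l = 0 := by
  induction m generalizing l with
  | zero =>
    unfold cycE
    rw [Finset.card_eq_zero, Finset.filter_eq_empty_iff]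
    intro σ _ hh
    have : cyclicDescents (0 + 1) σ = 0 := by
      rw [cyclicDescents_eq_sum]
      simp [Subsingleton.elim (finRotate 1) 1]
    omega
  | succ m ih =>
    obtain ⟨l, rfl⟩ : ∃ k, l = k + 1 := ⟨l - 1, by omega⟩
    rw [cycE_succ_succ, ih _ (by omega), ih l (by omega)]
    simp

/-- The trigonometric closed form. -/
noncomputable def cycF (k : ℕ) (w : ℂ) : ℂ :=
  ∑ l ∈ range (k + 2), (cycE k l : ℂ) * (Complex.cos ((k + 1 - 2 * l) * w) / Complex.sin w ^ (k + 1))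

lemma cycF_term_hasDerivAt (k : ℕ) (a w : ℂ) (hw : Complex.sin w ≠ 0) :
    HasDerivAt (fun w => Complex.cos ((k + 1 - 2 * a) * w) / Complex.sin w ^ (k + 1))
      (-(a * (Complex.cos ((k + 2 - 2 * a) * w) / Complex.sin w ^ (k + 2)) +
        (k + 1 - a) * (Complex.cos ((k + 2 - 2 * (a + 1)) * w) / Complex.sin w ^ (k + 2)))) w := by
  have h1 : HasDerivAt (fun w => Complex.cos ((k + 1 - 2 * a) * w))
      (-Complex.sin ((k + 1 - 2 * a) * w) * (k + 1 - 2 * a)) w := by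
    have := ((hasDerivAt_id w).const_mul ((k : ℂ) + 1 - 2 * a)).ccos
    simpa using this
  have h2 : HasDerivAt (fun w => Complex.sin w ^ (k + 1))
      ((k + 1) * Complex.sin w ^ k * Complex.cos w) w := by
    have := (Complex.hasDerivAt_sin w).fun_pow (k + 1)
    simpa using this
  convert! h1.div h2 (pow_ne_zero _ hw) using 1
  have e1 : ((k : ℂ) + 2 - 2 * a) * w = (k + 1 - 2 * a) * w + w := by ring
  have e2 : ((k : ℂ) + 2 - 2 * (a + 1)) * w = (k + 1 - 2 * a) * w - w := by ring
  rw [e1, e2, Complex.cos_add, Complex.cos_sub]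
  field_simp
  ring

lemma cycF_recurrence (k : ℕ) (g : ℕ → ℂ) :
    ∑ l ∈ range (k + 2), (cycE k l : ℂ) * ((l : ℂ) * g l + (k + 1 - l) * g (l + 1)) =
      ∑ l ∈ range (k + 3), (cycE (k + 1) l : ℂ) * g l := by
  have h1 : ∑ l ∈ range (k + 2), (cycE k l : ℂ) * ((l : ℂ) * g l) =
      ∑ l ∈ range (k + 2), (cycE k (l + 1) : ℂ) * (((l + 1 : ℕ) : ℂ) * g (l + 1)) := by
    have a := Finset.sum_range_succ (fun l => (cycE k l : ℂ) * ((l : ℂ) * g l)) (k + 2)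
    have b := Finset.sum_range_succ' (fun l => (cycE k l : ℂ) * ((l : ℂ) * g l)) (k + 2)
    rw [b] at a
    simp only [cycE_eq_zero k (k + 2) (by omega), Nat.cast_zero, zero_mul, mul_zero, add_zero] at a
    exact a.symm
  rw [Finset.sum_range_succ' _ (k + 2), cycE_succ_zero]
  simp only [mul_add, Finset.sum_add_distrib, Nat.cast_zero, zero_mul, add_zero]
  rw [h1, ← Finset.sum_add_distrib]
  refine Finset.sum_congr rfl fun l hl => ?_
  have hl' : l ≤ k + 1 := by have := Finset.mem_range.mp hl; omega
  rw [cycE_succ_succ]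
  push_cast [Nat.cast_sub hl']
  ring

lemma cycF_hasDerivAt (k : ℕ) (w : ℂ) (hw : Complex.sin w ≠ 0) :
    HasDerivAt (cycF k) (-cycF (k + 1) w) w := by
  have h : HasDerivAt (cycF k) (∑ l ∈ range (k + 2), (cycE k l : ℂ) *
      (-(l * (Complex.cos ((k + 2 - 2 * l) * w) / Complex.sin w ^ (k + 2)) +
        (k + 1 - l) * (Complex.cos ((k + 2 - 2 * (l + 1)) * w) / Complex.sin w ^ (k + 2))))) w := by
    unfold cycF
    exact HasDerivAt.fun_sum fun l _ => (cycF_term_hasDerivAt k l w hw).const_mul _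
  convert! h using 1
  have := cycF_recurrence k (fun l => Complex.cos ((k + 2 - 2 * l) * w) / Complex.sin w ^ (k + 2))
  simp only [mul_neg, Finset.sum_neg_distrib, neg_inj]
  unfold cycF
  push_cast at this ⊢
  rw [this]
  refine Finset.sum_congr rfl fun l _ => ?_
  congr 3
  ring_nf

lemma cycF_zero (w : ℂ) : cycF 0 w = Complex.cot w := by
  simp [cycF, Finset.sum_range_succ, cycE_zero_zero, cycE_eq_zero 0 1, Complex.cot]

lemma sin_pi_ne_zero_of_upper {z : ℂ} (hz : 0 < z.im) : Complex.sin (π * z) ≠ 0 := by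
  apply sin_pi_mul_ne_zero
  rintro ⟨k, rfl⟩
  simp at hz

lemma iterated_cot_eq (k : ℕ) : ∀ z : ℂ, 0 < z.im →
    iteratedDerivWithin k (fun x : ℂ ↦ π * Complex.cot (π * x)) {z : ℂ | 0 < z.im} z =
      (-1) ^ k * π ^ (k + 1) * cycF k (π * z) := by
  induction k with
  | zero => intro z hz; simp [cycF_zero]
  | succ k ih =>
    intro z hz
    have ho : IsOpen {z : ℂ | 0 < z.im} := isOpen_lt continuous_const Complex.continuous_im
    rw [iteratedDerivWithin_succ, derivWithin_congr (s := {z : ℂ | 0 < z.im}) (fun y hy => ih y hy) (ih z hz),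
      derivWithin_of_isOpen ho hz]
    have h1 : HasDerivAt (fun z : ℂ => (π : ℂ) * z) π z := by
      simpa using (hasDerivAt_id z).const_mul (π : ℂ)
    have h2 := ((cycF_hasDerivAt k (π * z) (sin_pi_ne_zero_of_upper hz)).comp z h1).const_mul
      ((-1 : ℂ) ^ k * π ^ (k + 1))
    have h3 := h2.deriv
    simp only [Function.comp_def] at h3
    rw [h3]
    ring

lemma tsum_upper (k : ℕ) (hk : 1 ≤ k) (z : ℂ) (hz : 0 < z.im) :
    ∑' n : ℤ, 1 / (z + n) ^ (k + 1) = π ^ (k + 1) / (k.factorial : ℂ) * cycF k (π * z) := by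
  have h := iteratedDerivWithin_cot_pi_mul_eq_mul_tsum_div_pow hk (z := z) hz
  have h2 := iterated_cot_eq k z hz
  have h3 := h.symm.trans h2
  have hf : (k.factorial : ℂ) ≠ 0 := by exact_mod_cast k.factorial_ne_zero
  have hs : ((-1 : ℂ)) ^ k ≠ 0 := pow_ne_zero _ (by norm_num)
  rw [mul_assoc, mul_assoc] at h3
  have h4 := mul_left_cancel₀ hs h3
  rw [div_mul_eq_mul_div, eq_div_iff hf, ← h4, mul_comm]

lemma cycF_continuousAt (k : ℕ) (w : ℂ) (hw : Complex.sin w ≠ 0) : ContinuousAt (cycF k) w :=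
  (cycF_hasDerivAt k w hw).continuousAt

lemma sin_pi_ne_zero_of_mem {x : ℝ} (hx : x ∈ Set.Ioo (0 : ℝ) 1) :
    Complex.sin (π * (x : ℂ)) ≠ 0 := by
  have : Real.sin (π * x) ≠ 0 := by
    apply ne_of_gt
    apply Real.sin_pos_of_pos_of_lt_pi
    · exact mul_pos Real.pi_pos hx.1
    · nlinarith [Real.pi_pos, hx.2]
  exact_mod_cast this

lemma summable_real (k : ℕ) (hk : 1 ≤ k) (x : ℝ) :
    Summable (fun n : ℤ => 1 / |x + n| ^ (k + 1)) := by
  have := (Real.summable_one_div_int_add_rpow x (k + 1 : ℝ)).mpr (by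
    have : (1 : ℝ) ≤ k := by exact_mod_cast hk
    linarith)
  refine this.congr fun n => ?_
  rw [add_comm x]
  norm_cast

lemma tsum_real (k : ℕ) (hk : 1 ≤ k) (x : ℝ) (hx : x ∈ Set.Ioo (0 : ℝ) 1) :
    ∑' n : ℤ, 1 / ((x : ℂ) + n) ^ (k + 1) =
      π ^ (k + 1) / (k.factorial : ℂ) * cycF k (π * x) := by
  let u : ℝ → ℂ := fun ε => (x : ℂ) + ε * Complex.I
  have hu : Continuous u := by fun_prop
  have hu0 : u 0 = x := by simp [u]
  have hne : ∀ n : ℤ, (x : ℝ) + n ≠ 0 := by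
    intro n h
    have h1 : (-1 : ℝ) < n := by linarith [hx.2]
    have h2 : (n : ℝ) < 0 := by linarith [hx.1]
    have h3 : (-1 : ℤ) < n := by exact_mod_cast h1
    have h4 : n < 0 := by exact_mod_cast h2
    omega
  have hL : Tendsto (fun ε : ℝ => ∑' n : ℤ, 1 / (u ε + n) ^ (k + 1)) (nhdsWithin 0 (Set.Ioi 0))
      (nhds (∑' n : ℤ, 1 / ((x : ℂ) + n) ^ (k + 1))) := by
    refine tendsto_tsum_of_dominated_convergence (summable_real k hk x) ?_ ?_
    · intro n
      have : ContinuousAt (fun ε : ℝ => 1 / (u ε + n) ^ (k + 1)) 0 := by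
        refine ContinuousAt.div continuousAt_const (by fun_prop) ?_
        rw [hu0]
        exact pow_ne_zero _ (by exact_mod_cast hne n)
      have h := this.tendsto
      rw [hu0] at h
      exact h.mono_left nhdsWithin_le_nhds
    · refine Eventually.of_forall fun ε n => ?_
      rw [norm_div, norm_one, norm_pow]
      have hp : 0 < |x + n| := abs_pos.mpr (hne n)
      have hle : |x + n| ≤ ‖u ε + n‖ := by
        have := Complex.abs_re_le_norm (u ε + n)
        simpa [u] using this
      gcongr
  have hR : Tendsto (fun ε : ℝ => π ^ (k + 1) / (k.factorial : ℂ) * cycF k (π * u ε))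
      (nhdsWithin 0 (Set.Ioi 0))
      (nhds (π ^ (k + 1) / (k.factorial : ℂ) * cycF k (π * x))) := by
    refine Tendsto.const_mul _ ?_
    have h1 : ContinuousAt (cycF k) (π * u 0) := by
      rw [hu0]; exact cycF_continuousAt k _ (sin_pi_ne_zero_of_mem hx)
    have h2 : ContinuousAt (fun ε : ℝ => cycF k (π * u ε)) 0 :=
      ContinuousAt.comp (f := fun ε : ℝ => (π : ℂ) * u ε) (g := cycF k) h1 (by fun_prop)
    have h := h2.tendsto
    rw [hu0] at h
    exact h.mono_left nhdsWithin_le_nhds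
  refine tendsto_nhds_unique hL (hR.congr' ?_)
  filter_upwards [self_mem_nhdsWithin] with ε hε
  have hε' : 0 < ε := hε
  exact (tsum_upper k hk (u ε) (by simpa [u] using hε')).symm

lemma hurwitz_pair (k : ℕ) (hk : 1 ≤ k) (x : ℝ) (hx : x ∈ Set.Ioo (0 : ℝ) 1) :
    HurwitzZeta.hurwitzZeta (x : UnitAddCircle) ((k + 1 : ℕ) : ℂ) +
      (-1) ^ (k + 1) * HurwitzZeta.hurwitzZeta (-(x : UnitAddCircle)) ((k + 1 : ℕ) : ℂ) =
      π ^ (k + 1) / (k.factorial : ℂ) * cycF k (π * x) := by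
  have hs : 1 < (((k + 1 : ℕ) : ℂ)).re := by
    rw [Complex.natCast_re]; exact_mod_cast (by omega : 1 < k + 1)
  have h1 := HurwitzZeta.hasSum_hurwitzZeta_of_one_lt_re (a := x) ⟨hx.1.le, hx.2.le⟩ hs
  have h2 := HurwitzZeta.hasSum_hurwitzZeta_of_one_lt_re (a := 1 - x)
    ⟨by linarith [hx.2], by linarith [hx.1]⟩ hs
  have hc : ((1 - x : ℝ) : UnitAddCircle) = -(x : UnitAddCircle) := by
    rw [AddCircle.coe_sub, AddCircle.coe_period, zero_sub]
  rw [hc] at h2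
  have h3 := h2.mul_left ((-1 : ℂ) ^ (k + 1))
  rw [← tsum_real k hk x hx]
  refine (HasSum.tsum_eq ?_).symm
  refine HasSum.of_nat_of_neg_add_one ?_ ?_
  · convert! h1 using 2 with n
    rw [Complex.cpow_natCast]
    push_cast; ring
  · convert! h3 using 2 with n
    rw [Complex.cpow_natCast]
    have : ((x : ℂ) + ((-((n : ℤ) + 1) : ℤ) : ℂ)) = (-1) * (n + ((1 - x : ℝ) : ℂ)) := by
      push_cast; ring
    rw [this, mul_pow, one_div, mul_inv, one_div]
    congr 1
    rw [← inv_pow]; norm_num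

lemma sum_zmod_eq (N : ℕ) [NeZero N] (f : ZMod N → ℂ) (h0 : f 0 = 0) :
    ∑ j, f j = ∑ m ∈ Finset.Icc 1 (N - 1), f (m : ZMod N) := by
  have hN : 0 < N := NeZero.pos N
  rw [← Finset.sum_erase univ h0]
  refine Finset.sum_bij' (fun j _ => j.val) (fun m _ => (m : ZMod N)) ?_ ?_ ?_ ?_ ?_
  · intro j hj
    have h1 : j ≠ 0 := by simpa using hj
    have h2 := ZMod.val_lt j
    have h3 : j.val ≠ 0 := by rwa [Ne, ZMod.val_eq_zero]
    rw [Finset.mem_Icc]; omega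
  · intro m hm
    rw [Finset.mem_Icc] at hm
    simp only [Finset.mem_erase, Finset.mem_univ, and_true]
    rw [Ne, ZMod.natCast_eq_zero_iff]
    intro hd
    have := Nat.le_of_dvd (by omega) hd
    omega
  · intro j _; simp
  · intro m hm
    rw [Finset.mem_Icc] at hm
    exact ZMod.val_natCast_of_lt (by omega)
  · intro j _; simp

/-- For a Dirichlet character `χ` mod `N` (`N > 2`) and an integer `n ≥ 2` with
`χ(-1) = (-1)^n`, the value `L(n,χ)` is given by
`(π^n / (2(n-1)! N^n)) ∑_{m=1}^{N-1} (χ(m)/sin^n(mπ/N)) ∑_{l=1}^{n-1} cos((n-2l)mπ/N) Ā(n,l)`. -/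
theorem LFunction_eq_circEulerian_sum (N : ℕ) [NeZero N] (hN : 2 < N)
    (χ : DirichletCharacter ℂ N) (n : ℕ) (hn : 2 ≤ n) (hpar : χ (-1) = (-1) ^ n) :
    DirichletCharacter.LFunction χ (n : ℂ) =
      ((π : ℂ) ^ n / (2 * (Nat.factorial (n - 1) : ℂ) * (N : ℂ) ^ n)) *
        ∑ m ∈ Finset.Icc 1 (N - 1),
          χ (m : ZMod N) / ((Real.sin ((m : ℝ) * π / N) : ℂ)) ^ n *
            ((∑ l ∈ Finset.Icc 1 (n - 1),
                Real.cos (((n : ℝ) - 2 * (l : ℝ)) * (m : ℝ) * π / N) *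
                  (circEulerian n l : ℝ) : ℝ) : ℂ) := by
  obtain ⟨k, rfl⟩ : ∃ k, n = k + 1 := ⟨n - 1, by omega⟩
  have hk : 1 ≤ k := by omega
  have hN0 : (N : ℂ) ≠ 0 := by exact_mod_cast NeZero.ne N
  have hf : (k.factorial : ℂ) ≠ 0 := by exact_mod_cast k.factorial_ne_zero
  have : Fact (1 < N) := ⟨by omega⟩
  have hχ0 : χ 0 = 0 := MulChar.map_zero χ
  set H : ZMod N → ℂ := fun j => HurwitzZeta.hurwitzZeta (ZMod.toAddCircle j) ((k + 1 : ℕ) : ℂ)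
    with hH
  have hL : DirichletCharacter.LFunction χ ((k + 1 : ℕ) : ℂ) =
      ((N : ℂ) ^ (k + 1))⁻¹ * ∑ j : ZMod N, χ j * H j := by
    rw [DirichletCharacter.LFunction, ZMod.LFunction, Complex.cpow_neg, Complex.cpow_natCast]
  have hneg : ∑ j : ZMod N, χ j * H j = ∑ j : ZMod N, χ j * ((-1) ^ (k + 1) * H (-j)) := by
    rw [← Equiv.sum_comp (Equiv.neg (ZMod N)) (fun j => χ j * H j)]
    refine Finset.sum_congr rfl fun j _ => ?_
    simp only [Equiv.neg_apply]
    rw [← neg_one_mul j, map_mul, hpar]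
    ring
  have h2 : 2 * ∑ j : ZMod N, χ j * H j =
      ∑ j : ZMod N, χ j * (H j + (-1) ^ (k + 1) * H (-j)) := by
    simp only [mul_add, Finset.sum_add_distrib]
    rw [← hneg]; ring
  have h3 : ∑ j : ZMod N, χ j * H j =
      (∑ j : ZMod N, χ j * (H j + (-1) ^ (k + 1) * H (-j))) / 2 := by
    rw [← h2]; ring
  rw [hL, h3, sum_zmod_eq N _ (by simp [hχ0]), Finset.sum_div, Finset.mul_sum, Finset.mul_sum]
  refine Finset.sum_congr rfl fun m hm => ?_
  rw [Finset.mem_Icc] at hm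
  have hNp : (0 : ℝ) < N := by exact_mod_cast NeZero.pos N
  have hx : ((m : ℝ) / N) ∈ Set.Ioo (0 : ℝ) 1 := by
    constructor
    · have : (0 : ℝ) < m := by exact_mod_cast hm.1
      positivity
    · rw [div_lt_one hNp]; exact_mod_cast (by omega : m < N)
  have hHm : H (m : ZMod N) + (-1) ^ (k + 1) * H (-(m : ZMod N)) =
      π ^ (k + 1) / (k.factorial : ℂ) * cycF k (π * ((m / N : ℝ) : ℂ)) := by
    rw [← hurwitz_pair k hk _ hx]
    simp only [hH, map_neg]
    have : ZMod.toAddCircle (m : ZMod N) = (((m : ℝ) / N : ℝ) : UnitAddCircle) := by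
      rw [ZMod.toAddCircle_natCast]
    rw [this]
  rw [hHm]
  have hF : cycF k (π * ((m / N : ℝ) : ℂ)) =
      ((∑ l ∈ Finset.Icc 1 (k + 1 - 1),
        Real.cos ((((k + 1 : ℕ) : ℝ) - 2 * (l : ℝ)) * (m : ℝ) * π / N) *
          (circEulerian (k + 1) l : ℝ) : ℝ) : ℂ) / (Real.sin ((m : ℝ) * π / N) : ℂ) ^ (k + 1) := by
    have hk0 : cycE k 0 = 0 := by
      obtain ⟨j, rfl⟩ : ∃ j, k = j + 1 := ⟨k - 1, by omega⟩
      exact cycE_succ_zero j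
    have hsub : Finset.Icc 1 (k + 1 - 1) ⊆ range (k + 2) := by
      intro l hl
      rw [Finset.mem_Icc] at hl
      rw [Finset.mem_range]; omega
    unfold cycF
    rw [← Finset.sum_subset hsub]
    · push_cast
      rw [Finset.sum_div]
      refine Finset.sum_congr rfl fun l _ => ?_
      rw [circEulerian_eq_cycE]
      have e1 : (π : ℂ) * (m / N) = m * π / N := by ring
      have e2 : ((k : ℂ) + 1 - 2 * l) * (m * π / N) = (k + 1 - 2 * l) * m * π / N := by ring
      rw [e1, e2]; ring
    · intro l hl hl'
      rw [Finset.mem_range] at hl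
      rw [Finset.mem_Icc] at hl'
      have : cycE k l = 0 := by
        rcases Nat.eq_zero_or_pos l with rfl | h
        · exact hk0
        · exact cycE_eq_zero k l (by omega)
      simp [this]
  rw [hF]
  simp only [Nat.add_sub_cancel]
  generalize ((∑ l ∈ Finset.Icc 1 k, Real.cos ((((k + 1 : ℕ) : ℝ) - 2 * (l : ℝ)) * (m : ℝ) * π / N) *
          (circEulerian (k + 1) l : ℝ) : ℝ) : ℂ) = S
  field_simp
end

section
/- Let N > 2 and let χ be an odd Dirichlet character modulo N. Then L(1, χ) = (π / (2N)) · ∑_{m=1}^{N−1} χ(m) · cot(mπ/N). -/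
open Finset Filter Real

lemma aux_bound1 {c x y s : ℝ} (hc : 0 < c) (hc1 : c ≤ 1) (hx : c ≤ x) (hxy : x ≤ y)
    (hy : y ≤ x + 1) (hs : 1 ≤ s) (hs2 : s ≤ 2) :
    |1 / x ^ s - 1 / y ^ s| ≤ 2 / (c * (x * y)) := by
  have hx0 : 0 < x := hc.trans_le hx
  have hy0 : 0 < y := hx0.trans_le hxy
  have hle : x ^ s ≤ y ^ s := rpow_le_rpow hx0.le hxy (by linarith)
  have hxs : 0 < x ^ s := rpow_pos_of_pos hx0 s
  have hys : 0 < y ^ s := rpow_pos_of_pos hy0 s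
  rw [abs_of_nonneg (sub_nonneg.mpr (one_div_le_one_div_of_le hxs hle))]
  have h1 : (x / y) ^ (2 : ℝ) ≤ (x / y) ^ s :=
    rpow_le_rpow_of_exponent_ge (by positivity) ((div_le_one hy0).mpr hxy) hs2
  rw [rpow_two, div_rpow hx0.le hy0.le] at h1
  have h2 : 1 / x ^ s ≤ 1 / (c * x) := by
    apply one_div_le_one_div_of_le (by positivity)
    have h3 : (x / c) ^ (1 : ℝ) ≤ (x / c) ^ s :=
      rpow_le_rpow_of_exponent_le ((one_le_div hc).mpr hx) hs
    have h4 : c ^ (2 : ℝ) ≤ c ^ s := rpow_le_rpow_of_exponent_ge hc hc1 hs2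
    rw [rpow_one, div_rpow hx0.le hc.le, div_le_div_iff₀ hc (rpow_pos_of_pos hc s)] at h3
    rw [rpow_two] at h4
    have : x * c ^ 2 ≤ x ^ s * c := le_trans (by gcongr) h3
    nlinarith
  have h5 : 1 - (x / y) ^ 2 ≤ 2 / y := by
    have e : 1 - (x / y) ^ 2 = (y - x) * (y + x) / y ^ 2 := by field_simp; ring
    rw [e, div_le_div_iff₀ (by positivity) hy0]
    have : (y - x) * (y + x) ≤ 1 * (2 * y) := by
      apply mul_le_mul <;> linarith
    nlinarith
  have e2 : 1 / x ^ s - 1 / y ^ s = (1 / x ^ s) * (1 - x ^ s / y ^ s) := by field_simp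
  rw [e2]
  calc (1 / x ^ s) * (1 - x ^ s / y ^ s) ≤ (1 / (c * x)) * (2 / y) := by
        apply mul_le_mul h2 (by linarith) _ (by positivity)
        exact sub_nonneg.mpr ((div_le_one hys).mpr hle)
    _ = _ := by field_simp

lemma aux_bound2 {c x y s : ℝ} (hc : 0 < c) (hc1 : c ≤ 1) (hx : c ≤ x) (hy : c ≤ y)
    (hxy : |x - y| ≤ 1) (hs : 1 ≤ s) (hs2 : s ≤ 2) :
    |1 / x ^ s - 1 / y ^ s| ≤ 2 / (c * (x * y)) := by
  rw [abs_le] at hxy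
  rcases le_total x y with h | h
  · exact aux_bound1 hc hc1 hx h (by linarith) hs hs2
  · rw [abs_sub_comm, mul_comm x y]
    exact aux_bound1 hc hc1 hy h (by linarith) hs hs2

lemma aux_bound3 {a c : ℝ} (hc : 0 < c) (hc1 : c ≤ 1) (h1 : c ≤ a) (h2 : c ≤ 1 - a) (n : ℕ)
    {s : ℝ} (hs : 1 ≤ s) (hs2 : s ≤ 2) :
    ‖((1 / (n + a : ℂ) ^ (s : ℂ) - 1 / (n + 1 - a : ℂ) ^ (s : ℂ)) / 2)‖
      ≤ 2 / c ^ 3 * (1 / ((n + 1 : ℕ) : ℝ) ^ 2) := by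
  have hn : (0 : ℝ) ≤ n := n.cast_nonneg
  have key := aux_bound2 (c := c) (x := n + a) (y := n + 1 - a) (s := s) hc hc1
    (by linarith) (by linarith) (by rw [abs_le]; constructor <;> linarith) hs hs2
  have e : (1 / (n + a : ℂ) ^ (s : ℂ) - 1 / (n + 1 - a : ℂ) ^ (s : ℂ)) / 2
      = (((1 / (n + a : ℝ) ^ s - 1 / (n + 1 - a : ℝ) ^ s) / 2 : ℝ) : ℂ) := by
    push_cast
    rw [Complex.ofReal_cpow (by linarith), Complex.ofReal_cpow (by linarith)]
    push_cast
    rfl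
  rw [e, Complex.norm_real, Real.norm_eq_abs, abs_div, abs_two]
  have h3 : c * (n + 1) ≤ n + a := by nlinarith
  have h4 : c * (n + 1) ≤ n + 1 - a := by nlinarith
  have h5 : 2 / (c * ((n + a) * (n + 1 - a))) ≤ 2 / (c * ((c * (n + 1)) * (c * (n + 1)))) := by
    gcongr
    linarith
  have h6 : 2 / (c * ((c * ((n : ℝ) + 1)) * (c * (n + 1))))
      = 2 / c ^ 3 * (1 / ((n + 1 : ℕ) : ℝ) ^ 2) := by
    push_cast
    field_simp
  have := abs_nonneg (1 / (n + a : ℝ) ^ s - 1 / (n + 1 - a : ℝ) ^ s)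
  linarith

lemma hurwitzZetaOdd_one_eq {a : ℝ} (ha0 : 0 < a) (ha1 : a < 1) :
    HurwitzZeta.hurwitzZetaOdd a 1 = (π / 2 : ℂ) * Complex.cot (π * a) := by
  obtain ⟨c, hc, hca, hca'⟩ : ∃ c : ℝ, 0 < c ∧ c ≤ a ∧ c ≤ 1 - a :=
    ⟨min a (1 - a), lt_min ha0 (by linarith), min_le_left _ _, min_le_right _ _⟩
  have hc1 : c ≤ 1 := by linarith
  have hsum : Summable (fun n : ℕ => 2 / c ^ 3 * (1 / ((n + 1 : ℕ) : ℝ) ^ 2)) :=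
    ((summable_nat_add_iff 1).mpr
      (Real.summable_one_div_nat_pow.mpr one_lt_two)).mul_left _
  -- the limit of the series
  have hne : ∀ n : ℕ, (n + a : ℂ) ≠ 0 := fun n => by
    have : (n + a : ℝ) ≠ 0 := by positivity
    exact_mod_cast this
  have hne' : ∀ n : ℕ, (n + 1 - a : ℂ) ≠ 0 := fun n => by
    have : (n + 1 - a : ℝ) ≠ 0 := by
      have hn : (0 : ℝ) ≤ n := n.cast_nonneg
      linarith
    exact_mod_cast this
  have hT : Tendsto (fun s : ℝ => ∑' n : ℕ,
      ((1 / (n + a : ℂ) ^ (s : ℂ) - 1 / (n + 1 - a : ℂ) ^ (s : ℂ)) / 2)) (nhdsWithin 1 (Set.Ioi 1))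
      (nhds (∑' n : ℕ, ((1 / (n + a : ℂ) ^ ((1 : ℝ) : ℂ)
        - 1 / (n + 1 - a : ℂ) ^ ((1 : ℝ) : ℂ)) / 2))) := by
    refine tendsto_tsum_of_dominated_convergence hsum ?_ ?_
    · intro n
      apply Tendsto.mono_left _ nhdsWithin_le_nhds
      apply ContinuousAt.tendsto
        (f := fun s : ℝ => ((1 / (n + a : ℂ) ^ (s : ℂ) - 1 / (n + 1 - a : ℂ) ^ (s : ℂ)) / 2))
      have hk : ∀ z : ℂ, z ≠ 0 → ContinuousAt (fun s : ℝ => 1 / z ^ (s : ℂ)) 1 := by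
        intro z hz
        refine ContinuousAt.div continuousAt_const ?_ (by simp [Complex.cpow_eq_zero_iff, hz])
        exact (continuousAt_const_cpow hz).comp Complex.continuous_ofReal.continuousAt
      exact ((hk _ (hne n)).sub (hk _ (hne' n))).div_const 2
    · have : Set.Ioo (1 : ℝ) 2 ∈ nhdsWithin (1 : ℝ) (Set.Ioi 1) :=
        Ioo_mem_nhdsGT one_lt_two
      filter_upwards [this] with s hs n
      exact aux_bound3 hc hc1 hca hca' n hs.1.le hs.2.le
  have hT2 : Tendsto (fun s : ℝ => HurwitzZeta.hurwitzZetaOdd a (s : ℂ))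
      (nhdsWithin 1 (Set.Ioi 1)) (nhds (HurwitzZeta.hurwitzZetaOdd a ((1 : ℝ) : ℂ))) := by
    apply Tendsto.mono_left _ nhdsWithin_le_nhds
    exact ((HurwitzZeta.differentiable_hurwitzZetaOdd a).continuous.comp
      Complex.continuous_ofReal).continuousAt.tendsto
  have hT3 : Tendsto (fun s : ℝ => HurwitzZeta.hurwitzZetaOdd a (s : ℂ))
      (nhdsWithin 1 (Set.Ioi 1)) (nhds (∑' n : ℕ, ((1 / (n + a : ℂ) ^ ((1 : ℝ) : ℂ)
        - 1 / (n + 1 - a : ℂ) ^ ((1 : ℝ) : ℂ)) / 2))) := by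
    refine hT.congr' ?_
    filter_upwards [self_mem_nhdsWithin] with s hs
    exact (HurwitzZeta.hasSum_nat_hurwitzZetaOdd_of_mem_Icc ⟨ha0.le, ha1.le⟩
      (by simpa using hs)).tsum_eq
  have hval := tendsto_nhds_unique hT2 hT3
  have hsum1 : Summable (fun n : ℕ => ((1 / (n + a : ℂ) ^ ((1 : ℝ) : ℂ)
        - 1 / (n + 1 - a : ℂ) ^ ((1 : ℝ) : ℂ)) / 2)) :=
    Summable.of_norm_bounded hsum fun n => aux_bound3 hc hc1 hca hca' n le_rfl one_le_two
  have hlim1 := hsum1.hasSum.tendsto_sum_nat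
  rw [← hval] at hlim1
  simp only [Complex.ofReal_one, Complex.cpow_one] at hlim1
  -- cotangent
  have haZ : (a : ℂ) ∈ Complex.integerComplement := by
    rintro ⟨m, hm⟩
    have hm' : (m : ℝ) = a := by exact_mod_cast hm
    have h1 : (0 : ℝ) < m := by linarith
    have h2 : (m : ℝ) < 1 := by linarith
    have h1' : 0 < m := by exact_mod_cast h1
    have h2' : m < 1 := by exact_mod_cast h2
    omega
  have hcot := tendsto_logDeriv_euler_cot_sub haZ
  have hz : Tendsto (fun n : ℕ => 1 / (n + a : ℂ)) atTop (nhds 0) := by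
    have h : Tendsto (fun n : ℕ => 1 / (n + a : ℝ)) atTop (nhds 0) := by
      simp only [one_div]
      exact (tendsto_atTop_add_const_right _ a tendsto_natCast_atTop_atTop).inv_tendsto_atTop
    have := (Complex.continuous_ofReal.tendsto 0).comp h
    simpa [Function.comp_def] using this
  have hpart : ∀ M : ℕ, ∑ n ∈ Finset.range M, ((1 / (n + a : ℂ) - 1 / (n + 1 - a : ℂ)) / 2)
      = (1 / a + ∑ n ∈ Finset.range M, cotTerm a n - 1 / (M + a : ℂ)) / 2 := by
    intro M
    induction M with
    | zero => simp
    | succ k ih =>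
      rw [Finset.sum_range_succ, Finset.sum_range_succ, ih]
      have e : (1 : ℂ) / (a - (k + 1)) = - (1 / (k + 1 - a)) := by
        rw [← neg_sub, div_neg]
      simp only [cotTerm, e]
      push_cast
      ring
  simp only [hpart] at hlim1
  have hlim2 := ((hcot.const_add (1 / (a : ℂ))).sub hz).div_const 2
  have := tendsto_nhds_unique hlim1 hlim2
  rw [this]
  ring

/-- For an odd Dirichlet character `χ` mod `N` (`N > 2`),
`L(1,χ) = (π/(2N)) ∑_{m=1}^{N-1} χ(m) cot(mπ/N)`. -/
theorem LFunction_one_eq_cot_sum (N : ℕ) [NeZero N] (hN : 2 < N)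
    (χ : DirichletCharacter ℂ N) (hodd : χ (-1) = -1) :
    DirichletCharacter.LFunction χ 1 =
      ((π : ℂ) / (2 * (N : ℂ))) *
        ∑ m ∈ Finset.Icc 1 (N - 1), χ (m : ZMod N) * ((Real.cot ((m : ℝ) * π / N) : ℂ)) := by
  have hO : Function.Odd (χ : ZMod N → ℂ) := DirichletCharacter.Odd.to_fun hodd
  have hN0 : (0 : ℝ) < N := by exact_mod_cast (by omega : 0 < N)
  rw [DirichletCharacter.LFunction, ZMod.LFunction_def_odd hO, Complex.cpow_neg_one]
  have hsum : ∑ j : ZMod N, χ j * HurwitzZeta.hurwitzZetaOdd (ZMod.toAddCircle j) 1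
      = ∑ m ∈ Finset.range N, χ (m : ZMod N) *
        HurwitzZeta.hurwitzZetaOdd (ZMod.toAddCircle (m : ZMod N)) 1 := by
    refine Finset.sum_bij' (fun j _ => j.val) (fun m _ => (m : ZMod N)) ?_ ?_ ?_ ?_ ?_
    · intro j _
      simpa using ZMod.val_lt j
    · intros; simp
    · intro j _; simp
    · intro m hm
      exact ZMod.val_cast_of_lt (by simpa using hm)
    · intro j _; simp
  have h0 : χ ((0 : ℕ) : ZMod N) = 0 := by
    have : Fact (1 < N) := ⟨by omega⟩
    rw [Nat.cast_zero]
    exact MulChar.map_zero χ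
  have hr : Finset.range N = insert 0 (Finset.Icc 1 (N - 1)) := by
    ext m; simp; omega
  rw [hsum, hr, Finset.sum_insert (by simp), h0, zero_mul, zero_add, Finset.mul_sum,
    Finset.mul_sum]
  refine Finset.sum_congr rfl fun m hm => ?_
  rw [Finset.mem_Icc] at hm
  have hm1 : (0 : ℝ) < m := by exact_mod_cast (by omega : 0 < m)
  have hm2 : (m : ℝ) < N := by exact_mod_cast (by omega : m < N)
  rw [ZMod.toAddCircle_natCast, hurwitzZetaOdd_one_eq (div_pos hm1 hN0) ((div_lt_one hN0).mpr hm2),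
    Complex.ofReal_cot]
  have e : (π : ℂ) * ((m / N : ℝ) : ℂ) = (((m : ℝ) * π / N : ℝ) : ℂ) := by
    push_cast; ring
  rw [e]
  have : (N : ℂ) ≠ 0 := by exact_mod_cast hN0.ne'
  field_simp
end
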